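/- arXiv:math/0111087 — 2 statements merged into one kernel-verified Lean document; each statement's English description precedes it below -/
import Mathlib

section
/- If A and B are finitely generated groups with asdim A ≤ n and asdim B ≤ n, and C is a common finitely generated subgroup, then the amalgamated free product A ∗_C B satisfies asdim(A ∗_C B) ≤ n + 1. -/
open Set Monoid

/-- Asymptotic dimension `≤ n` of a set with a distance function `ρ`. -/
def ASDimLEdist {Z : Type*} (ρ : Z → Z → ℝ) (n : ℕ) : Prop :=
  ∀ d : ℝ, 0 < d → ∃ 𝔘 : Fin (n + 1) → Set (Set Z),
    (∀ i, (∃ R : ℝ, ∀ U ∈ 𝔘 i, ∀ x ∈ U, ∀ y ∈ U, ρ x y ≤ R) ∧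
      (∀ U ∈ 𝔘 i, ∀ V ∈ 𝔘 i, U ≠ V → ∀ x ∈ U, ∀ y ∈ V, d ≤ ρ x y)) ∧
    ∀ z : Z, ∃ i, ∃ U ∈ 𝔘 i, z ∈ U

/-- The word distance on a group associated with a (symmetric) generating set `S`. -/
noncomputable def wordDist {Γ : Type*} [Group Γ] (S : Set Γ) (g h : Γ) : ℕ :=
  sInf {n : ℕ | ∃ l : List Γ, l.length = n ∧ (∀ s ∈ l, s ∈ S) ∧ l.prod = g⁻¹ * h}

/-- The amalgamated free product `A ∗_C B` along injections `ja : C → A`, `jb : C → B`: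
the quotient of the free product `A ∗ B` by the normal closure of the elements
`ja(c) · jb(c)⁻¹`. -/
def AmalgamatedProduct {A B C : Type*} [Group A] [Group B] [Group C]
    (ja : C →* A) (jb : C →* B) : Type _ :=
  Coprod A B ⧸ Subgroup.normalClosure
    {x : Coprod A B | ∃ c : C, x = Coprod.inl (ja c) * (Coprod.inr (jb c))⁻¹}

instance {A B C : Type*} [Group A] [Group B] [Group C] (ja : C →* A) (jb : C →* B) :
    Group (AmalgamatedProduct ja jb) := by
  unfold AmalgamatedProduct; infer_instance


namespace AsdimAmalg

/-- Integer valued pseudometrics. -/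
structure NMet {X : Type*} (d : X → X → ℕ) : Prop where
  refl : ∀ x, d x x = 0
  symm : ∀ x y, d x y = d y x
  tri : ∀ x y z, d x z ≤ d x y + d y z

/-- `r`-chain connectedness inside `P`. -/
def Conn {X : Type*} (d : X → X → ℕ) (r : ℕ) (P : X → Prop) : X → X → Prop :=
  Relation.ReflTransGen (fun x y => P x ∧ P y ∧ d x y ≤ r)

/-- Coloring version of asymptotic dimension `≤ n` for the subset `W`. -/
def AD {X : Type*} (d : X → X → ℕ) (W : Set X) (n : ℕ) : Prop :=
  ∀ r : ℕ, ∃ D : ℕ, ∃ c : X → Fin (n + 1), ∀ i x y,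
    Conn d r (fun z => z ∈ W ∧ c z = i) x y → d x y ≤ D

theorem Conn.map {X Y : Type*} {d : X → X → ℕ} {d' : Y → Y → ℕ} {r r' : ℕ} {P : X → Prop}
    {P' : Y → Prop} (f : X → Y) (hP : ∀ x, P x → P' (f x))
    (hd : ∀ x y, P x → P y → d x y ≤ r → d' (f x) (f y) ≤ r') {x y : X}
    (h : Conn d r P x y) : Conn d' r' P' (f x) (f y) := by
  induction h with
  | refl => exact Relation.ReflTransGen.refl
  | tail _ h ih =>
    exact Relation.ReflTransGen.tail ih ⟨hP _ h.1, hP _ h.2.1, hd _ _ h.1 h.2.1 h.2.2⟩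

theorem Conn.mono {X : Type*} {d : X → X → ℕ} {r : ℕ} {P P' : X → Prop}
    (hP : ∀ x, P x → P' x) {x y : X}
    (h : Conn d r P x y) : Conn d r P' x y :=
  Conn.map (f := fun x => x) hP (fun _ _ _ _ h => h) h

theorem Conn.eq_or {X : Type*} {d : X → X → ℕ} {r : ℕ} {P : X → Prop} {x y : X}
    (h : Conn d r P x y) : x = y ∨ (P x ∧ P y) := by
  induction h with
  | refl => exact Or.inl rfl
  | tail _ h ih =>
    rcases ih with rfl | ih
    · exact Or.inr ⟨h.1, h.2.1⟩
    · exact Or.inr ⟨ih.1, h.2.1⟩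

theorem Conn.symm {X : Type*} {d : X → X → ℕ} (hd : NMet d) {r : ℕ} {P : X → Prop} {x y : X}
    (h : Conn d r P x y) : Conn d r P y x := by
  induction h with
  | refl => exact Relation.ReflTransGen.refl
  | tail _ h ih =>
    exact Relation.ReflTransGen.head ⟨h.2.1, h.1, by rw [hd.symm]; exact h.2.2⟩ ih

/-- A locally constant function is constant along chains. -/
theorem Conn.const {X ι : Type*} {d : X → X → ℕ} {r : ℕ} {P : X → Prop} (φ : X → ι)
    (hφ : ∀ x y, P x → P y → d x y ≤ r → φ x = φ y) {x y : X}
    (h : Conn d r P x y) : Conn d r (fun z => P z ∧ φ z = φ x) x y := by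
  have key : Conn d r (fun z => P z ∧ φ z = φ x) x y ∧ φ y = φ x := by
    induction h with
    | refl => exact ⟨Relation.ReflTransGen.refl, rfl⟩
    | tail _ h ih =>
      have e := hφ _ _ h.1 h.2.1 h.2.2
      exact ⟨Relation.ReflTransGen.tail ih.1 ⟨⟨h.1, ih.2⟩, ⟨h.2.1, by rw [← e, ih.2]⟩, h.2.2⟩,
        by rw [← e, ih.2]⟩
  exact key.1

/-- Saturation lemma. -/
theorem Conn.saturate {X : Type*} {d : X → X → ℕ} (hd : NMet d) {r D E : ℕ} {P Q : X → Prop}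
    (hQ : ∀ x y, Conn d r Q x y → d x y ≤ D)
    (hP : ∀ x y, Conn d (D + 2 * r) P x y → d x y ≤ E) {x y : X}
    (h : Conn d r (fun z => P z ∨ Q z) x y) : d x y ≤ E + 2 * (D + r) := by
  have key : Conn d r Q x y ∨ ∃ p p', d x p ≤ D + r ∧ Conn d (D + 2 * r) P p p' ∧ P p' ∧
      (y = p' ∨ ∃ q, d p' q ≤ r ∧ Conn d r Q q y ∧ Q y) := by
    induction h with
    | refl => exact Or.inl Relation.ReflTransGen.refl
    | @tail y z _ h ih =>
      obtain ⟨hy, hz, hyz⟩ := h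
      rcases ih with ih | ⟨p, p', h1, h2, h3, h4⟩
      · by_cases hPz : P z
        · right
          refine ⟨z, z, ?_, Relation.ReflTransGen.refl, hPz, Or.inl rfl⟩
          have := hQ _ _ ih
          have := hd.tri x y z
          omega
        · have hQz : Q z := hz.resolve_left hPz
          by_cases hPy : P y
          · right
            refine ⟨y, y, ?_, Relation.ReflTransGen.refl, hPy,
              Or.inr ⟨z, hyz, Relation.ReflTransGen.refl, hQz⟩⟩
            have := hQ _ _ ih
            omega
          · have hQy : Q y := hy.resolve_left hPy
            exact Or.inl (Relation.ReflTransGen.tail ih ⟨hQy, hQz, hyz⟩)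
      · right
        have hp'y : d p' y ≤ r + D := by
          rcases h4 with rfl | ⟨q, h5, h6, _⟩
          · rw [hd.refl]; omega
          · have := hQ _ _ h6
            have := hd.tri p' q y
            omega
        by_cases hPz : P z
        · refine ⟨p, z, h1, Relation.ReflTransGen.tail h2 ⟨h3, hPz, ?_⟩, hPz, Or.inl rfl⟩
          have := hd.tri p' y z
          omega
        · have hQz : Q z := hz.resolve_left hPz
          refine ⟨p, p', h1, h2, h3, Or.inr ?_⟩
          rcases h4 with rfl | ⟨q, h5, h6, h7⟩
          · exact ⟨z, hyz, Relation.ReflTransGen.refl, hQz⟩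
          · exact ⟨q, h5, Relation.ReflTransGen.tail h6 ⟨h7, hQz, hyz⟩, hQz⟩
  rcases key with h | ⟨p, p', h1, h2, h3, h4⟩
  · have := hQ _ _ h
    omega
  · have hp'y : d p' y ≤ r + D := by
      rcases h4 with rfl | ⟨q, h5, h6, _⟩
      · rw [hd.refl]; omega
      · have := hQ _ _ h6
        have := hd.tri p' q y
        omega
    have := hP _ _ h2
    have := hd.tri x p y
    have := hd.tri p p' y
    omega

/-- Pulling back colorings along coarse maps. -/
theorem AD.comap {X Y : Type*} {d : X → X → ℕ} {d' : Y → Y → ℕ} (hd' : NMet d') {U : Set X}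
    {V : Set Y} {n : ℕ} (h : AD d U n) (f : Y → X) (hf : ∀ y ∈ V, f y ∈ U)
    (h1 : ∀ r, ∃ s, ∀ x ∈ V, ∀ y ∈ V, d' x y ≤ r → d (f x) (f y) ≤ s)
    (h2 : ∀ r, ∃ s, ∀ x ∈ V, ∀ y ∈ V, d (f x) (f y) ≤ r → d' x y ≤ s) : AD d' V n := by
  intro r
  obtain ⟨s, hs⟩ := h1 r
  obtain ⟨D, c, hc⟩ := h s
  obtain ⟨E, hE⟩ := h2 D
  refine ⟨E, fun y => c (f y), fun i x y hxy => ?_⟩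
  rcases hxy.eq_or with rfl | ⟨hx, hy⟩
  · rw [hd'.refl]; omega
  · refine hE x hx.1 y hy.1 (hc i _ _ ?_)
    exact Conn.map f (fun z hz => ⟨hf z hz.1, hz.2⟩)
      (fun a b ha hb hab => hs a ha.1 b hb.1 hab) hxy

theorem AD.of_asdim {X : Type*} {d : X → X → ℕ} (hd : NMet d) {n : ℕ}
    (h : ASDimLEdist (fun x y => (d x y : ℝ)) n) : AD d Set.univ n := by
  intro r
  obtain ⟨𝔘, h1, h2⟩ := h (r + 1) (by positivity)
  choose c U hU hz using h2
  choose R hR using fun i => (h1 i).1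
  refine ⟨Finset.univ.sup (fun i => ⌈R i⌉₊), c, fun i x y hxy => ?_⟩
  rcases hxy.eq_or with rfl | ⟨hx, hy⟩
  · rw [hd.refl]; omega
  · have hc := Conn.const (fun z => U z) (fun a b ha hb hab => by
      by_contra hne
      have hbU := hU b
      rw [hb.2, ← ha.2] at hbU
      have := (h1 (c a)).2 _ (hU a) _ hbU hne a (hz a) b (hz b)
      have h3 : (d a b : ℝ) ≤ r := by exact_mod_cast hab
      linarith) hxy
    rcases hc.eq_or with rfl | ⟨_, hy'⟩
    · rw [hd.refl]; omega
    · have e : U y = U x := hy'.2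
      have hyx : y ∈ U x := e ▸ hz y
      have := hR (c x) (U x) (hU x) x (hz x) y hyx
      have h4 : d x y ≤ ⌈R (c x)⌉₊ := by
        have h5 : (d x y : ℝ) ≤ (⌈R (c x)⌉₊ : ℝ) := this.trans (Nat.le_ceil _)
        exact_mod_cast h5
      exact h4.trans (Finset.le_sup (f := fun i => ⌈R i⌉₊) (Finset.mem_univ _))

theorem AD.to_asdim {X : Type*} {d : X → X → ℕ} (hd : NMet d) {n : ℕ}
    (h : AD d Set.univ n) : ASDimLEdist (fun x y => (d x y : ℝ)) n := by
  intro δ _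
  obtain ⟨D, c, hc⟩ := h ⌈δ⌉₊
  refine ⟨fun i => {U | ∃ x, c x = i ∧
    U = {y | c y = i ∧ Conn d ⌈δ⌉₊ (fun z => z ∈ Set.univ ∧ c z = i) x y}}, fun i => ⟨?_, ?_⟩, ?_⟩
  · refine ⟨D, ?_⟩
    rintro U ⟨x0, hx0, rfl⟩ x ⟨_, hx⟩ y ⟨_, hy⟩
    have h5 := hc i x y (Relation.ReflTransGen.trans (hx.symm hd) hy)
    change (d x y : ℝ) ≤ (D : ℝ)
    exact_mod_cast h5
  · rintro U ⟨x0, hx0, rfl⟩ V ⟨y0, hy0, rfl⟩ hne x ⟨hxc, hx⟩ y ⟨hyc, hy⟩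
    by_contra hlt
    push Not at hlt
    apply hne
    have hxy : d x y ≤ ⌈δ⌉₊ := by
      have := hlt.le.trans (Nat.le_ceil δ)
      exact_mod_cast this
    have hxy' : Conn d ⌈δ⌉₊ (fun z => z ∈ Set.univ ∧ c z = i) x y :=
      Relation.ReflTransGen.single ⟨⟨trivial, hxc⟩, ⟨trivial, hyc⟩, hxy⟩
    have h0 : Conn d ⌈δ⌉₊ (fun z => z ∈ Set.univ ∧ c z = i) x0 y0 :=
      Relation.ReflTransGen.trans hx (Relation.ReflTransGen.trans hxy' (hy.symm hd))
    ext z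
    constructor
    · rintro ⟨hz, h⟩
      exact ⟨hz, Relation.ReflTransGen.trans (h0.symm hd) h⟩
    · rintro ⟨hz, h⟩
      exact ⟨hz, Relation.ReflTransGen.trans h0 h⟩
  · intro z
    exact ⟨c z, _, ⟨z, rfl, rfl⟩, rfl, Relation.ReflTransGen.refl⟩

/-- The state of a band: a triangular wave. -/
def wave (N b : ℕ) : ℕ := if (b / N) % 2 = 0 then b % N else N - b % N

theorem wave_le {N : ℕ} (hN : 0 < N) (b : ℕ) : wave N b ≤ N := by
  unfold wave
  have := Nat.mod_lt b hN
  split_ifs <;> omega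

theorem band_step {N : ℕ} (hN : 0 < N) (b : ℕ) :
    ((b + 1) / N = b / N ∧ (b + 1) % N = b % N + 1) ∨
    ((b + 1) / N = b / N + 1 ∧ (b + 1) % N = 0 ∧ b % N + 1 = N) := by
  have h1 := Nat.mod_lt b hN
  have h2 := Nat.div_add_mod b N
  by_cases h : b % N + 1 < N
  · left
    have e : b + 1 = (b % N + 1) + N * (b / N) := by omega
    constructor
    · conv_lhs => rw [e]
      rw [Nat.add_mul_div_left _ _ hN, Nat.div_eq_of_lt h]; omega
    · conv_lhs => rw [e]
      rw [Nat.add_mul_mod_self_left, Nat.mod_eq_of_lt h]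
  · right
    have h3 : b % N + 1 = N := by omega
    have e : b + 1 = N * (b / N + 1) := by rw [mul_add]; omega
    refine ⟨?_, ?_, h3⟩
    · conv_lhs => rw [e]
      rw [Nat.mul_div_cancel_left _ hN]
    · conv_lhs => rw [e]
      exact Nat.mul_mod_right _ _

theorem wave_step_F {N : ℕ} (hN : 0 < N) (b b' : ℕ) (h : b ≤ b' + 1) (h' : b' ≤ b + 1)
    (hb : wave N b < N) (hb' : wave N b' < N) : (b / N + 1) / 2 = (b' / N + 1) / 2 := by
  have key : ∀ b, wave N b < N → wave N (b + 1) < N →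
      (b / N + 1) / 2 = ((b + 1) / N + 1) / 2 := by
    intro b hb hb'
    unfold wave at *
    have h1 := Nat.mod_lt b hN
    rcases band_step hN b with ⟨e1, e2⟩ | ⟨e1, e2, e3⟩ <;> rw [e1, e2] at hb' <;> rw [e1]
    split_ifs at hb hb' <;> omega
  rcases (by omega : b = b' ∨ b' = b + 1 ∨ b = b' + 1) with rfl | rfl | rfl
  · rfl
  · exact key _ hb hb'
  · exact (key _ hb' hb).symm

theorem wave_step_C {N : ℕ} (hN : 0 < N) (b b' : ℕ) (h : b ≤ b' + 1) (h' : b' ≤ b + 1)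
    (hb : 0 < wave N b) (hb' : 0 < wave N b') : (b / N) / 2 = (b' / N) / 2 := by
  have key : ∀ b, 0 < wave N b → 0 < wave N (b + 1) →
      (b / N) / 2 = ((b + 1) / N) / 2 := by
    intro b hb hb'
    unfold wave at *
    have h1 := Nat.mod_lt b hN
    rcases band_step hN b with ⟨e1, e2⟩ | ⟨e1, e2, e3⟩ <;> rw [e1, e2] at hb' <;> rw [e1]
    split_ifs at hb hb' <;> omega
  rcases (by omega : b = b' ∨ b' = b + 1 ∨ b = b' + 1) with rfl | rfl | rfl
  · rfl
  · exact key _ hb hb'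
  · exact (key _ hb' hb).symm

theorem wave_step {N : ℕ} (hN : 0 < N) (b b' : ℕ) (h : b ≤ b' + 1) (h' : b' ≤ b + 1) :
    wave N b ≤ wave N b' + 1 := by
  have key : ∀ b, wave N b ≤ wave N (b + 1) + 1 ∧ wave N (b + 1) ≤ wave N b + 1 := by
    intro b
    unfold wave at *
    have h1 := Nat.mod_lt b hN
    rcases band_step hN b with ⟨e1, e2⟩ | ⟨e1, e2, e3⟩ <;> rw [e1, e2]
    · split_ifs <;> omega
    · split_ifs <;> omega
  rcases (by omega : b = b' ∨ b' = b + 1 ∨ b = b' + 1) with rfl | rfl | rfl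
  · omega
  · exact (key _).1
  · exact (key _).2

/-- Hurewicz type theorem for maps to `ℕ`. -/
theorem hurewicz {X : Type*} {d : X → X → ℕ} (hd : NMet d) (h : X → ℕ) (n : ℕ)
    (hlip : ∀ r, ∃ w, ∀ x y, d x y ≤ r → h x ≤ h y + w)
    (hann : ∀ r L, ∃ D, ∀ a, ∃ c : X → Fin (n + 1), ∀ i x y,
      Conn d r (fun z => (a ≤ h z ∧ h z ≤ a + L) ∧ c z = i) x y → d x y ≤ D) :
    AD d Set.univ (n + 1) := by
  intro r
  obtain ⟨w0, hw0⟩ := hlip r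
  set w := w0 + 1 with hw
  set N := n + 2 with hN
  have hN0 : 0 < N := by omega
  have hw' : 0 < w := by omega
  -- the fine coloring
  obtain ⟨D, hD⟩ := hann r (2 * N * w)
  choose cF hcF using hD
  -- the coarse coloring
  obtain ⟨E, hE⟩ := hann (D + 2 * r) w
  choose cC hcC using hE
  let b : X → ℕ := fun x => h x / w
  let s : X → ℕ := fun x => wave N (b x)
  let kF : X → ℕ := fun x => (b x / N + 1) / 2
  let kC : X → ℕ := fun x => (b x / N) / 2
  let F : X → Fin (n + 1) := fun x => cF (w * ((2 * kF x - 1) * N)) x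
  let C : X → Fin (n + 1) := fun x => cC (w * ((2 * kC x + 1) * N)) x
  have hstep : ∀ x y, d x y ≤ r → b x ≤ b y + 1 := by
    intro x y hxy
    have h1 := hw0 x y hxy
    calc b x ≤ (h y + w) / w := Nat.div_le_div_right (by omega)
      _ = b y + 1 := Nat.add_div_right _ hw'
  have hstep' : ∀ x y, d x y ≤ r → b y ≤ b x + 1 := fun x y hxy =>
    hstep y x (by rw [hd.symm]; exact hxy)
  have hbw : ∀ x, w * b x ≤ h x ∧ h x ≤ w * b x + w := by
    intro x
    have h1 := Nat.div_add_mod (h x) w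
    have h2 := Nat.mod_lt (h x) hw'
    change w * (h x / w) ≤ h x ∧ h x ≤ w * (h x / w) + w
    omega
  have hF : ∀ i x y, Conn d r (fun z => s z < N ∧ F z = i) x y → d x y ≤ D := by
    intro i x y hxy
    have h1 := Conn.const kF (fun a a' ha ha' haa' =>
      wave_step_F hN0 _ _ (hstep _ _ haa') (hstep' _ _ haa') ha.1 ha'.1) hxy
    refine hcF (w * ((2 * kF x - 1) * N)) i x y (Conn.mono ?_ h1)
    rintro z ⟨⟨hz1, hz2⟩, hz3⟩
    refine ⟨?_, ?_⟩
    · obtain ⟨h2, h3⟩ := hbw z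
      have h4 := Nat.div_add_mod (b z) N
      have h5 := Nat.mod_lt (b z) hN0
      have h6 : 2 * kF x - 1 ≤ b z / N := by
        change (b z / N + 1) / 2 = kF x at hz3
        generalize b z / N = q at hz3 ⊢
        omega
      have h7 : b z / N ≤ 2 * kF x - 1 + 1 := by
        change (b z / N + 1) / 2 = kF x at hz3
        generalize b z / N = q at hz3 ⊢
        omega
      constructor
      · refine le_trans (Nat.mul_le_mul_left w ?_) h2
        have : (2 * kF x - 1) * N ≤ b z / N * N := Nat.mul_le_mul_right _ h6
        have e : b z / N * N = N * (b z / N) := mul_comm _ _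
        omega
      · have h8 : b z + 1 ≤ (2 * kF x - 1) * N + 2 * N := by
          have : b z / N * N ≤ (2 * kF x - 1 + 1) * N := Nat.mul_le_mul_right _ h7
          have e : b z / N * N = N * (b z / N) := mul_comm _ _
          rw [add_mul] at this
          omega
        have h9 := Nat.mul_le_mul_left w h8
        rw [mul_add, mul_add, mul_one] at h9
        have e : 2 * N * w = w * (2 * N) := mul_comm _ _
        omega
    · rw [← hz3]; exact hz2
  have hC : ∀ k i x y, Conn d (D + 2 * r) (fun z => (s z = N ∧ kC z = k) ∧ C z = i) x y →
      d x y ≤ E := by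
    intro k i x y hxy
    refine hcC (w * ((2 * k + 1) * N)) i x y (Conn.mono ?_ hxy)
    rintro z ⟨⟨hz1, hz2⟩, hz3⟩
    have hb : b z = (2 * k + 1) * N := by
      have h4 := Nat.div_add_mod (b z) N
      have h5 := Nat.mod_lt (b z) hN0
      change wave N (b z) = N at hz1
      change (b z / N) / 2 = k at hz2
      have h6 : b z / N = 2 * k + 1 ∧ b z % N = 0 := by
        unfold wave at hz1
        split_ifs at hz1 <;> omega
      rw [h6.1, h6.2, mul_comm] at h4
      omega
    refine ⟨?_, ?_⟩
    · rw [← hb]; exact hbw z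
    · rw [← hz2]; exact hz3
  -- the final coloring
  let col : X → ℕ := fun x =>
    if s x = N then (C x : ℕ) + 1
    else if (F x : ℕ) + s x < n + 1 then (F x : ℕ) else (F x : ℕ) + 1
  have hcol : ∀ x, col x < n + 1 + 1 := by
    intro x
    have h1 := (F x).2
    have h2 := (C x).2
    change (if s x = N then (C x : ℕ) + 1
      else if (F x : ℕ) + s x < n + 1 then (F x : ℕ) else (F x : ℕ) + 1) < n + 1 + 1
    split_ifs <;> omega
  refine ⟨E + 2 * (D + r), fun x => ⟨col x, hcol x⟩, fun a x y hxy => ?_⟩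
  have hsle : ∀ x, s x ≤ N := fun x => wave_le hN0 _
  have hcases : ∀ z, col z = a → (s z + a < n + 1 ∧ s z < N ∧ (F z : ℕ) = a) ∨
      (n + 1 < s z + a ∧ 0 < s z ∧ 0 < (a : ℕ) ∧ ((s z = N ∧ (C z : ℕ) + 1 = a) ∨
        (s z < N ∧ (F z : ℕ) + 1 = a))) := by
    intro z hz
    have h1 := (F z).2
    have h2 := (C z).2
    have h3 := hsle z
    have h4 := a.2
    change (if s z = N then (C z : ℕ) + 1
      else if (F z : ℕ) + s z < n + 1 then (F z : ℕ) else (F z : ℕ) + 1) = a at hz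
    split_ifs at hz <;> omega
  have hxy1 : Conn d r (fun z => col z = a) x y :=
    Conn.mono (fun z hz => by have := hz.2; rw [← this]) hxy
  have hxy2 := Conn.const (fun z => decide (s z + a < n + 1)) (fun u v hu hv huv => by
    have h1 := hcases u hu
    have h2 := hcases v hv
    have h3 : s u ≤ s v + 1 := wave_step hN0 _ _ (hstep _ _ huv) (hstep' _ _ huv)
    have h4 : s v ≤ s u + 1 := wave_step hN0 _ _ (hstep' _ _ huv) (hstep _ _ huv)
    simp only [decide_eq_decide]
    omega) hxy1
  by_cases hx : s x + a < n + 1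
  · have ha : (a : ℕ) < n + 1 := by omega
    have := hF ⟨a, ha⟩ x y (Conn.mono (fun z hz => by
      have h1 := hcases z hz.1
      have h2 : s z + a < n + 1 := by
        have := hz.2
        simp only [decide_eq_decide] at this
        exact this.2 hx
      refine ⟨by omega, Fin.ext ?_⟩
      change (F z : ℕ) = a
      omega) hxy2)
    omega
  · have hzone : ∀ z, (col z = a ∧ decide (s z + a < n + 1) = decide (s x + a < n + 1)) →
        (n + 1 < s z + a ∧ 0 < s z ∧ 0 < (a : ℕ) ∧ ((s z = N ∧ (C z : ℕ) + 1 = a) ∨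
        (s z < N ∧ (F z : ℕ) + 1 = a))) := by
      rintro z ⟨hz1, hz2⟩
      simp only [decide_eq_decide] at hz2
      refine (hcases z hz1).resolve_left (fun h => hx (hz2.1 h.1))
    rcases hxy2.eq_or with rfl | ⟨hx2, _⟩
    · rw [hd.refl]; omega
    have ha0 : 0 < (a : ℕ) := (hzone x hx2).2.2.1
    have ha : (a : ℕ) - 1 < n + 1 := by have := a.2; omega
    have hxy3 := Conn.const kC (fun u v hu hv huv =>
      wave_step_C hN0 _ _ (hstep _ _ huv) (hstep' _ _ huv) (hzone u hu).2.1 (hzone v hv).2.1) hxy2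
    refine Conn.saturate hd (r := r) (hF ⟨a - 1, ha⟩) (hC (kC x) ⟨a - 1, ha⟩) (Conn.mono ?_ hxy3)
    rintro z ⟨hz1, hz2⟩
    rcases (hzone z hz1).2.2.2 with ⟨h1, h2⟩ | ⟨h1, h2⟩
    · refine Or.inl ⟨⟨h1, hz2⟩, Fin.ext ?_⟩
      change (C z : ℕ) = a - 1
      omega
    · refine Or.inr ⟨h1, Fin.ext ?_⟩
      change (F z : ℕ) = a - 1
      omega

/-- Proper length functions. -/
structure PL {Γ : Type*} [Group Γ] (ℓ : Γ → ℕ) : Prop where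
  one : ℓ 1 = 0
  inv : ∀ g, ℓ g⁻¹ = ℓ g
  mul : ∀ g h, ℓ (g * h) ≤ ℓ g + ℓ h
  fin : ∀ r, {g | ℓ g ≤ r}.Finite

/-- The right invariant distance. -/
def rd {Γ : Type*} [Group Γ] (ℓ : Γ → ℕ) (x y : Γ) : ℕ := ℓ (x * y⁻¹)

theorem PL.nmet {Γ : Type*} [Group Γ] {ℓ : Γ → ℕ} (h : PL ℓ) : NMet (rd ℓ) where
  refl x := by simp [rd, h.one]
  symm x y := by
    unfold rd
    rw [← h.inv (x * y⁻¹)]; simp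
  tri x y z := by
    unfold rd
    have := h.mul (x * y⁻¹) (y * z⁻¹)
    simpa [mul_assoc] using this

/-- Functions are bounded on balls. -/
theorem PL.bound {Γ : Type*} [Group Γ] {ℓ : Γ → ℕ} (h : PL ℓ) (f : Γ → ℕ) (r : ℕ) :
    ∃ s, ∀ g, ℓ g ≤ r → f g ≤ s := by
  obtain ⟨s, hs⟩ := ((h.fin r).image f).bddAbove
  exact ⟨s, fun g hg => hs ⟨g, hg, rfl⟩⟩

theorem rd_mul_right {Γ : Type*} [Group Γ] (ℓ : Γ → ℕ) (x y g : Γ) :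
    rd ℓ (x * g) (y * g) = rd ℓ x y := by
  simp [rd, mul_assoc]

/-- The combinatorial data coming from normal forms. -/
structure TreeData (Γ ι α : Type*) [Group Γ] where
  τ : Γ → List α
  idx : α → ι
  P : List α → Γ
  M : ι → Set Γ
  move : ∀ i, ∀ m ∈ M i, ∀ x, ∃ t, (τ x = t ∨ ∃ e, idx e = i ∧ τ x = e :: t) ∧
    (τ (m * x) = t ∨ ∃ e, idx e = i ∧ τ (m * x) = e :: t)
  cut : ∀ x u v, τ x = v ++ u → τ (x * (P u)⁻¹) = v
  letter : ∀ x e, τ x = [e] → x ∈ M (idx e)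
  nil : ∀ x, τ x = [] → ∀ i, x ∈ M i
  gen : ∀ g, ∃ l : List Γ, (∀ m ∈ l, ∃ i, m ∈ M i) ∧ l.prod = g

namespace TreeData

variable {Γ ι α : Type*} [Group Γ] (T : TreeData Γ ι α)

/-- depth -/
def h (x : Γ) : ℕ := (T.τ x).length

/-- last `k` letters -/
def last (k : ℕ) (l : List α) : List α := l.drop (l.length - k)

theorem last_cons {k : ℕ} {l : List α} (e : α) (hk : k ≤ l.length) : last k (e :: l) = last k l := by
  unfold last
  have : (e :: l).length - k = (l.length - k) + 1 := by simp; omega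
  rw [this, List.drop_succ_cons]

theorem last_self {k : ℕ} {l : List α} (hk : l.length = k) : last k l = l := by
  unfold last
  simp [hk]

/-- the key of level `k` -/
def key (k : ℕ) (l : List α) : List ι × List α := ((last (k + 1) l).map T.idx, last k l)

theorem key_step {k : ℕ} {i : ι} {t l l' : List α} (h1 : l = t ∨ ∃ e, T.idx e = i ∧ l = e :: t)
    (h2 : l' = t ∨ ∃ e, T.idx e = i ∧ l' = e :: t) (hl : k + 1 ≤ l.length)
    (hl' : k + 1 ≤ l'.length) : T.key k l = T.key k l' := by
  by_cases ht : k + 1 ≤ t.length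
  · have aux : ∀ l, (l = t ∨ ∃ e, T.idx e = i ∧ l = e :: t) → T.key k l = T.key k t := by
      rintro l (rfl | ⟨e, _, rfl⟩)
      · rfl
      · unfold key
        rw [last_cons e ht, last_cons e (by omega)]
    rw [aux l h1, aux l' h2]
  · have aux : ∀ l, (l = t ∨ ∃ e, T.idx e = i ∧ l = e :: t) → k + 1 ≤ l.length →
        T.key k l = (i :: t.map T.idx, t) := by
      rintro l (rfl | ⟨e, he, rfl⟩) hl
      · omega
      · simp only [List.length_cons] at hl
        unfold key
        rw [last_self (by simp; omega), last_cons e (by omega), last_self (by omega)]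
        simp [he]
    rw [aux l h1 hl, aux l' h2 hl']

theorem h_move {i : ι} {m : Γ} (hm : m ∈ T.M i) (x : Γ) :
    T.h (m * x) ≤ T.h x + 1 ∧ T.h x ≤ T.h (m * x) + 1 := by
  obtain ⟨t, h1, h2⟩ := T.move i m hm x
  unfold h
  rcases h1 with h1 | ⟨e, _, h1⟩ <;> rcases h2 with h2 | ⟨e', _, h2⟩ <;> rw [h1, h2] <;>
    (try simp only [List.length_cons]) <;> omega

theorem h_list (l : List Γ) (hl : ∀ m ∈ l, ∃ i, m ∈ T.M i) (x : Γ) :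
    T.h (l.prod * x) ≤ T.h x + l.length ∧ T.h x ≤ T.h (l.prod * x) + l.length := by
  induction l with
  | nil => simp
  | cons m l ih =>
    have ih := ih (fun m' hm' => hl m' (List.mem_cons_of_mem _ hm'))
    obtain ⟨i, hi⟩ := hl m List.mem_cons_self
    have := T.h_move hi (l.prod * x)
    rw [List.prod_cons, mul_assoc, List.length_cons]
    omega

theorem key_list (k : ℕ) (l : List Γ) (hl : ∀ m ∈ l, ∃ i, m ∈ T.M i) (x : Γ)
    (hx : ∀ l', l' <:+ l → k < T.h (l'.prod * x)) :
    T.key k (T.τ (l.prod * x)) = T.key k (T.τ x) := by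
  induction l with
  | nil => simp
  | cons m l ih =>
    have ih := ih (fun m' hm' => hl m' (List.mem_cons_of_mem _ hm'))
      (fun l' hl' => hx l' (hl'.trans (List.suffix_cons m l)))
    obtain ⟨i, hi⟩ := hl m List.mem_cons_self
    rw [← ih]
    have h1 := hx (m :: l) (List.suffix_refl _)
    have h2 := hx l (List.suffix_cons m l)
    rw [List.prod_cons, mul_assoc] at h1 ⊢
    obtain ⟨t, h3, h4⟩ := T.move i m hi (l.prod * x)
    exact T.key_step h4 h3 h1 h2

variable {ℓ : Γ → ℕ}

theorem unif_gen (hℓ : PL ℓ) (r : ℕ) : ∃ K, ∀ x y, rd ℓ x y ≤ r → ∃ l : List Γ,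
    (∀ m ∈ l, ∃ i, m ∈ T.M i) ∧ y = l.prod * x ∧ l.length ≤ K ∧
    ∀ l', l' <:+ l → rd ℓ x (l'.prod * x) ≤ K := by
  choose L hL1 hL2 using T.gen
  obtain ⟨K, hK⟩ := hℓ.bound (fun g => (L g).length + ((L g).tails.map (fun l => ℓ l.prod)).sum) r
  refine ⟨K, fun x y hxy => ⟨L (y * x⁻¹), hL1 _, ?_, ?_, ?_⟩⟩
  · rw [hL2]; simp
  · have := hK (y * x⁻¹) (by rw [hℓ.nmet.symm] at hxy; exact hxy)
    omega
  · intro l' hl'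
    have h1 := hK (y * x⁻¹) (by rw [hℓ.nmet.symm] at hxy; exact hxy)
    have h2 : ℓ l'.prod ≤ ((L (y * x⁻¹)).tails.map (fun l => ℓ l.prod)).sum := by
      apply List.single_le_sum (by simp)
      exact List.mem_map.2 ⟨l', (List.mem_tails _ _).2 hl', rfl⟩
    have h3 : rd ℓ x (l'.prod * x) = ℓ l'.prod := by
      rw [hℓ.nmet.symm]
      simp [rd]
    rw [h3]
    omega

theorem lip (hℓ : PL ℓ) (r : ℕ) : ∃ w, ∀ x y, rd ℓ x y ≤ r → T.h x ≤ T.h y + w := by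
  obtain ⟨K, hK⟩ := T.unif_gen hℓ r
  refine ⟨K, fun x y hxy => ?_⟩
  obtain ⟨l, hl, rfl, h1, _⟩ := hK x y hxy
  have := T.h_list l hl x
  omega

/-- Balls in the tree. -/
def W (k : ℕ) : Set Γ := {x | T.h x ≤ k}

theorem nbhd (hℓ : PL ℓ) {V : Set Γ} {n : ℕ} (hV : AD (rd ℓ) V n) (K : ℕ) :
    AD (rd ℓ) {x | ∃ y ∈ V, rd ℓ x y ≤ K} n := by
  classical
  have hd := hℓ.nmet
  let f : Γ → Γ := fun x => if hx : ∃ y ∈ V, rd ℓ x y ≤ K then hx.choose else x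
  have hf : ∀ x, (∃ y ∈ V, rd ℓ x y ≤ K) → f x ∈ V ∧ rd ℓ x (f x) ≤ K := by
    intro x hx
    have : f x = hx.choose := dif_pos hx
    rw [this]
    exact hx.choose_spec
  refine AD.comap hd hV f (fun y hy => (hf y hy).1) (fun r => ⟨r + 2 * K, ?_⟩)
    (fun r => ⟨r + 2 * K, ?_⟩)
  · intro x hx y hy hxy
    have h1 := (hf x hx).2
    have h2 := (hf y hy).2
    have h3 := hd.tri (f x) x (f y)
    have h4 := hd.tri x y (f y)
    rw [hd.symm (f x) x] at h3
    omega
  · intro x hx y hy hxy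
    have h1 := (hf x hx).2
    have h2 := (hf y hy).2
    have h3 := hd.tri x (f x) y
    have h4 := hd.tri (f x) (f y) y
    rw [hd.symm (f y) y] at h4
    omega

theorem AD_W (hℓ : PL ℓ) [Finite ι] [Nonempty ι] {n : ℕ} (hM : ∀ i, AD (rd ℓ) (T.M i) n) (k : ℕ) :
    AD (rd ℓ) (T.W k) n := by
  classical
  have hd := hℓ.nmet
  induction k with
  | zero =>
    obtain ⟨i⟩ := ‹Nonempty ι›
    refine AD.comap hd (hM i) (fun x => x) (fun y hy => ?_) (fun r => ⟨r, fun _ _ _ _ h => h⟩)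
      (fun r => ⟨r, fun _ _ _ _ h => h⟩)
    refine T.nil y ?_ i
    have hy : (T.τ y).length ≤ 0 := hy
    exact List.length_eq_zero_iff.1 (by omega)
  | succ k ih =>
    intro r
    obtain ⟨K, hK⟩ := T.unif_gen hℓ r
    choose D0 c0 hc0 using fun i => hM i r
    have := Fintype.ofFinite ι
    let D := Finset.univ.sup D0
    have hDle : ∀ i, D0 i ≤ D := fun i => Finset.le_sup (Finset.mem_univ i)
    let Y : Set Γ := {x | ∃ y ∈ T.W k, rd ℓ x y ≤ K}
    obtain ⟨E, C, hC⟩ := nbhd hℓ ih K (D + 2 * r)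
    let F : Γ → Fin (n + 1) := fun x =>
      match T.τ x with
      | [] => 0
      | e :: u => c0 (T.idx e) (x * (T.P u)⁻¹)
    have hWY : ∀ x ∈ T.W k, x ∈ Y := fun x hx => ⟨x, hx, by rw [hd.refl]; omega⟩
    have hQ : ∀ i x y, Conn (rd ℓ) r (fun z => (z ∉ Y ∧ T.h z = k + 1) ∧ F z = i) x y →
        rd ℓ x y ≤ D := by
      intro i x y hxy
      have h1 := Conn.const (fun z => T.key k (T.τ z)) (fun u v hu hv huv => by
        obtain ⟨l, hl, rfl, _, h2⟩ := hK u v huv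
        refine (T.key_list k l hl u (fun l' hl' => ?_)).symm
        by_contra hlt
        exact hu.1.1 ⟨_, not_lt.1 hlt, h2 l' hl'⟩) hxy
      rcases hxy.eq_or with rfl | ⟨hx, hy⟩
      · rw [hd.refl]; omega
      have hkey : ∀ z, T.h z = k + 1 → ∃ e u, T.τ z = e :: u ∧
          T.key k (T.τ z) = (T.idx e :: u.map T.idx, u) := by
        intro z hz
        unfold h at hz
        cases hz' : T.τ z with
        | nil => simp [hz'] at hz
        | cons e u =>
          rw [hz', List.length_cons] at hz
          refine ⟨e, u, rfl, ?_⟩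
          unfold key
          rw [last_self (by simp; omega), last_cons e (by omega), last_self (by omega)]
          simp
      obtain ⟨e, u, hx1, hx2⟩ := hkey x hx.1.2
      refine le_trans ?_ (hDle (T.idx e))
      rw [← rd_mul_right ℓ x y (T.P u)⁻¹]
      refine hc0 (T.idx e) i _ _ (Conn.map (fun z => z * (T.P u)⁻¹) ?_ ?_ h1)
      · rintro z ⟨⟨⟨_, hz1⟩, hz2⟩, hz3⟩
        obtain ⟨e', u', hz4, hz5⟩ := hkey z hz1
        rw [hz5, hx2] at hz3
        simp only [Prod.mk.injEq, List.cons.injEq] at hz3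
        obtain ⟨⟨he, _⟩, rfl⟩ := hz3
        refine ⟨?_, ?_⟩
        · rw [← he]
          exact T.letter _ _ (T.cut z u' [e'] (by simpa using hz4))
        · rw [← he, ← hz2]
          change _ = (match T.τ z with
            | [] => 0
            | e :: u => c0 (T.idx e) (z * (T.P u)⁻¹))
          rw [hz4]
      · intro a b _ _ hab
        rw [rd_mul_right]; exact hab
    refine ⟨E + 2 * (D + r), fun x => if x ∈ Y then C x else F x, fun i x y hxy => ?_⟩
    refine Conn.saturate hd (hQ i) (hC i) (Conn.mono ?_ hxy)
    rintro z ⟨hz1, hz2⟩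
    replace hz2 : (if z ∈ Y then C z else F z) = i := hz2
    by_cases hz : z ∈ Y
    · rw [if_pos hz] at hz2
      exact Or.inl ⟨hz, hz2⟩
    · rw [if_neg hz] at hz2
      refine Or.inr ⟨⟨hz, ?_⟩, hz2⟩
      have h1 : T.h z ≤ k + 1 := hz1
      have h2 : ¬ T.h z ≤ k := fun h => hz (hWY z h)
      omega

theorem main (hℓ : PL ℓ) [Finite ι] [Nonempty ι] {n : ℕ} (hM : ∀ i, AD (rd ℓ) (T.M i) n) :
    AD (rd ℓ) Set.univ (n + 1) := by
  have hd := hℓ.nmet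
  refine hurewicz hd T.h n (T.lip hℓ) ?_
  intro r L
  obtain ⟨K, hK⟩ := T.unif_gen hℓ r
  obtain ⟨D, c, hc⟩ := T.AD_W hℓ hM (L + K + 1) r
  refine ⟨D, fun a => ?_⟩
  let m := a - (K + 1)
  refine ⟨fun x => c (x * (T.P (last m (T.τ x)))⁻¹), fun i x y hxy => ?_⟩
  have h1 := Conn.const (fun z => last m (T.τ z)) (fun u v hu hv huv => by
    by_cases ha : K + 1 ≤ a
    · obtain ⟨l, hl, rfl, h2, _⟩ := hK u v huv
      have h3 := T.key_list m l hl u (fun l' hl' => by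
        have h4 := T.h_list l' (fun m hm => hl m (hl'.subset hm)) u
        have h5 := hl'.length_le
        have h6 := hu.1.1
        omega)
      exact (congrArg Prod.snd h3).symm
    · have hm : m = 0 := by omega
      simp [last, hm]) hxy
  rw [← rd_mul_right ℓ x y (T.P (last m (T.τ x)))⁻¹]
  refine hc i _ _ (Conn.map (fun z => z * (T.P (last m (T.τ x)))⁻¹) ?_ ?_ h1)
  · rintro z ⟨⟨⟨hz1, hz1'⟩, hz2⟩, hz3⟩
    rw [← hz3]
    refine ⟨?_, hz2⟩
    have h2 := T.cut z (last m (T.τ z)) ((T.τ z).take ((T.τ z).length - m))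
      (by unfold last; rw [List.take_append_drop])
    change (T.τ _).length ≤ _
    rw [h2, List.length_take]
    have h3 : (T.τ z).length ≤ a + L := hz1'
    omega
  · intro a b _ _ hab
    rw [rd_mul_right]; exact hab

end TreeData

section Pushout

open Monoid.PushoutI Monoid.PushoutI.NormalWord

variable {ι : Type*} {G : ι → Type*} {H : Type*} [∀ i, Group (G i)] [Group H]
  {φ : ∀ i, H →* G i} [DecidableEq ι] [∀ i, DecidableEq (G i)]

theorem rcons_list {d : Transversal φ} (i : ι) (p : Pair d i) :
    (rcons i p).toList = p.tail.toList ∨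
      ∃ g : G i, (rcons i p).toList = ⟨i, g⟩ :: p.tail.toList := by
  unfold rcons
  simp only [CoprodI.Word.equivPair_symm]
  unfold CoprodI.Word.rcons
  split_ifs with h
  · left; rfl
  · right; exact ⟨_, rfl⟩

/-- Product of a list of letters. -/
def lprod (φ : ∀ i, H →* G i) (u : List (Σ i, G i)) : PushoutI φ :=
  (u.map (fun e => (of e.1 e.2 : PushoutI φ))).prod

theorem prod_eq_lprod {d : Transversal φ} (w : NormalWord d) :
    w.prod = base φ w.head * lprod φ w.toList := by
  unfold NormalWord.prod lprod CoprodI.Word.prod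
  rw [map_list_prod, List.map_map]
  congr 3

theorem prod_toList {d : Transversal φ} (x : PushoutI φ) :
    x = base φ (x • (empty : NormalWord d)).head *
      lprod φ (x • (empty : NormalWord d)).toList := by
  rw [← prod_eq_lprod, prod_smul, NormalWord.prod_empty, mul_one]

/-- The tree data of an amalgamated product. -/
noncomputable def pushoutTree (d : Transversal φ) [Nonempty ι] :
    TreeData (PushoutI φ) ι (Σ i, G i) where
  τ x := (x • (empty : NormalWord d)).toList
  idx e := e.1
  P := lprod φ
  M i := Set.range (of i : G i → PushoutI φ)
  move := by
    rintro i _ ⟨g, rfl⟩ x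
    rw [mul_smul]
    generalize x • (empty : NormalWord d) = w
    refine ⟨(equivPair i w).tail.toList, ?_, ?_⟩
    · have h := rcons_list i (equivPair i w)
      have e : rcons i (equivPair i w) = w := (equivPair i).symm_apply_apply w
      rw [e] at h
      rcases h with h | ⟨g', h⟩
      · exact Or.inl h
      · exact Or.inr ⟨⟨i, g'⟩, rfl, h⟩
    · rw [summand_smul_def]
      have h := rcons_list i ({ equivPair i w with head := g * (equivPair i w).head } : Pair d i)
      rcases h with h | ⟨g', h⟩
      · exact Or.inl h
      · exact Or.inr ⟨⟨i, g'⟩, rfl, h⟩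
  cut := by
    intro x u v hx
    have hprod := prod_toList (d := d) x
    generalize x • (empty : NormalWord d) = w at hx hprod
    let w' : NormalWord d :=
      { toList := v
        ne_one := fun l hl => w.ne_one l (by rw [hx]; exact List.mem_append_left _ hl)
        chain_ne := by
          have := w.chain_ne
          rw [hx] at this
          exact this.left_of_append
        head := w.head
        normalized := fun i g hg => w.normalized i g (by rw [hx]; exact List.mem_append_left _ hg) }
    have h1 : x * (lprod φ u)⁻¹ = w'.prod := by
      rw [prod_eq_lprod, hprod, hx]
      simp [lprod, mul_assoc, w']
    rw [h1, prod_smul_empty]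
  letter := by
    rintro x ⟨i, g⟩ hx
    have hprod := prod_toList (d := d) x
    rw [hx] at hprod
    refine ⟨φ i (x • (empty : NormalWord d)).head * g, ?_⟩
    rw [map_mul, of_apply_eq_base]
    conv_rhs => rw [hprod]
    simp [lprod]
  nil := by
    intro x hx i
    have hprod := prod_toList (d := d) x
    rw [hx] at hprod
    refine ⟨φ i (x • (empty : NormalWord d)).head, ?_⟩
    rw [of_apply_eq_base]
    conv_rhs => rw [hprod]
    simp [lprod]
  gen := by
    intro g
    induction g using PushoutI.induction_on with
    | of i g => exact ⟨[of i g], fun m hm => ⟨i, g, (List.mem_singleton.1 hm).symm⟩, by simp⟩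
    | base h =>
      obtain ⟨i⟩ := ‹Nonempty ι›
      exact ⟨[of i (φ i h)], fun m hm => ⟨i, φ i h, (List.mem_singleton.1 hm).symm⟩,
        by simp [of_apply_eq_base]⟩
    | mul x y ihx ihy =>
      obtain ⟨l, hl, rfl⟩ := ihx
      obtain ⟨l', hl', rfl⟩ := ihy
      refine ⟨l ++ l', ?_, by simp⟩
      intro m hm
      rcases List.mem_append.1 hm with hm | hm
      · exact hl m hm
      · exact hl' m hm

end Pushout

theorem AD_range {Γ A : Type*} [Group Γ] [Group A] {ℓ : Γ → ℕ} (hℓ : PL ℓ) {ℓA : A → ℕ}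
    (hA : PL ℓA) (f : A →* Γ) (hf : Function.Injective f) {n : ℕ}
    (h : AD (fun a b => ℓA (a⁻¹ * b)) Set.univ n) : AD (rd ℓ) (Set.range f) n := by
  classical
  let g : Γ → A := fun x => if hx : ∃ a, f a = x then hx.choose⁻¹ else 1
  have hg : ∀ x ∈ Set.range f, f (g x)⁻¹ = x := by
    intro x hx
    have hx' : ∃ a, f a = x := hx
    have : g x = hx'.choose⁻¹ := dif_pos hx'
    rw [this, inv_inv]
    exact hx'.choose_spec
  have key : ∀ x ∈ Set.range f, ∀ y ∈ Set.range f, rd ℓ x y = ℓ (f ((g x)⁻¹ * g y)) := by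
    intro x hx y hy
    unfold rd
    conv_lhs => rw [← hg x hx, ← hg y hy]
    simp
  refine AD.comap hℓ.nmet h g (fun _ _ => trivial) (fun r => ?_) (fun r => ?_)
  · have hfin : {a | ℓ (f a) ≤ r}.Finite := (hℓ.fin r).preimage hf.injOn
    obtain ⟨s, hs⟩ := (hfin.image ℓA).bddAbove
    refine ⟨s, fun x hx y hy hxy => hs ⟨_, ?_, rfl⟩⟩
    rw [key x hx y hy] at hxy
    exact hxy
  · obtain ⟨s, hs⟩ := hA.bound (fun a => ℓ (f a)) r
    refine ⟨s, fun x hx y hy hxy => ?_⟩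
    rw [key x hx y hy]
    exact hs _ hxy

theorem pushout_main {ι : Type*} {G : ι → Type*} {H : Type*} [∀ i, Group (G i)] [Group H]
    (φ : ∀ i, H →* G i) (hφ : ∀ i, Function.Injective (φ i)) [Finite ι] [Nonempty ι] (n : ℕ)
    (hG : ∀ i, ∃ ℓA : G i → ℕ, PL ℓA ∧ AD (fun a b => ℓA (a⁻¹ * b)) Set.univ n)
    {ℓ : PushoutI φ → ℕ} (hℓ : PL ℓ) : AD (rd ℓ) Set.univ (n + 1) := by
  classical
  obtain ⟨d⟩ := PushoutI.NormalWord.transversal_nonempty φ hφ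
  refine (pushoutTree d).main hℓ (fun i => ?_)
  obtain ⟨ℓA, h1, h2⟩ := hG i
  exact AD_range hℓ h1 (PushoutI.of i) (PushoutI.of_injective hφ i) h2

section WordLength

variable {Γ : Type*} [Group Γ]

theorem exists_word {S : Set Γ} (hS : Subgroup.closure S = ⊤) (hinv : ∀ s ∈ S, s⁻¹ ∈ S) (g : Γ) :
    ∃ l : List Γ, (∀ s ∈ l, s ∈ S) ∧ l.prod = g := by
  have hg : g ∈ Subgroup.closure S := by rw [hS]; trivial
  rw [← Subgroup.mem_toSubmonoid, Subgroup.closure_toSubmonoid] at hg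
  obtain ⟨l, hl, rfl⟩ := Submonoid.exists_list_of_mem_closure hg
  refine ⟨l, fun s hs => ?_, rfl⟩
  rcases hl s hs with h | h
  · exact h
  · simpa using hinv _ h

theorem wordDist_spec {S : Set Γ} (hS : Subgroup.closure S = ⊤) (hinv : ∀ s ∈ S, s⁻¹ ∈ S)
    (g h : Γ) : ∃ l : List Γ, l.length = wordDist S g h ∧ (∀ s ∈ l, s ∈ S) ∧ l.prod = g⁻¹ * h := by
  have hne : {n : ℕ | ∃ l : List Γ, l.length = n ∧ (∀ s ∈ l, s ∈ S) ∧ l.prod = g⁻¹ * h}.Nonempty := by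
    obtain ⟨l, hl, h1⟩ := exists_word hS hinv (g⁻¹ * h)
    exact ⟨l.length, l, rfl, hl, h1⟩
  exact Nat.sInf_mem hne

theorem wordDist_le {S : Set Γ} {g h : Γ} (l : List Γ) (hl : ∀ s ∈ l, s ∈ S)
    (h1 : l.prod = g⁻¹ * h) : wordDist S g h ≤ l.length :=
  Nat.sInf_le ⟨l, rfl, hl, h1⟩

theorem wordDist_eq (S : Set Γ) (g h : Γ) : wordDist S g h = wordDist S 1 (g⁻¹ * h) := by
  simp [wordDist]

theorem wordLength_PL (S : Finset Γ) (hS : Subgroup.closure (S : Set Γ) = ⊤)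
    (hinv : ∀ s ∈ S, s⁻¹ ∈ S) : PL (fun g => wordDist (S : Set Γ) 1 g) := by
  have hinv' : ∀ s ∈ (S : Set Γ), s⁻¹ ∈ (S : Set Γ) := hinv
  have hle : ∀ g, wordDist (S : Set Γ) 1 g⁻¹ ≤ wordDist (S : Set Γ) 1 g := by
    intro g
    obtain ⟨l, h1, h2, h3⟩ := wordDist_spec hS hinv' 1 g
    rw [← h1]
    refine (wordDist_le (l.map (·⁻¹)).reverse ?_ ?_).trans (by simp)
    · intro s hs
      simp only [List.mem_reverse, List.mem_map] at hs
      obtain ⟨t, ht, rfl⟩ := hs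
      exact hinv' t (h2 t ht)
    · rw [← List.prod_inv_reverse, h3]; simp
  refine ⟨?_, ?_, ?_, ?_⟩
  · have := wordDist_le (S := (S : Set Γ)) (g := 1) (h := 1) [] (by simp) (by simp)
    simpa using this
  · intro g
    refine le_antisymm (hle g) ?_
    have := hle g⁻¹
    simpa using this
  · intro g h
    obtain ⟨l, h1, h2, h3⟩ := wordDist_spec hS hinv' 1 g
    obtain ⟨l', h1', h2', h3'⟩ := wordDist_spec hS hinv' 1 h
    rw [← h1, ← h1', ← List.length_append]
    refine wordDist_le _ ?_ ?_
    · intro s hs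
      rcases List.mem_append.1 hs with hs | hs
      · exact h2 s hs
      · exact h2' s hs
    · rw [List.prod_append, h3, h3']; simp
  · intro r
    have hfin : {l : List {x // x ∈ S} | l.length ≤ r}.Finite := List.finite_length_le _ _
    refine (hfin.image (fun l : List {x // x ∈ S} => (l.map Subtype.val).prod)).subset ?_
    intro g hg
    obtain ⟨l, h1, h2, h3⟩ := wordDist_spec hS hinv' 1 g
    refine ⟨l.attach.map (fun s => (⟨s.1, h2 s.1 s.2⟩ : {x // x ∈ S})), ?_, ?_⟩
    · have hg' : wordDist (S : Set Γ) 1 g ≤ r := hg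
      change (l.attach.map (fun s => (⟨s.1, h2 s.1 s.2⟩ : {x // x ∈ S}))).length ≤ r
      rw [List.length_map, List.length_attach]
      omega
    · simp only [List.map_map]
      have : ((Subtype.val : {x // x ∈ S} → Γ) ∘
          fun s : {x // x ∈ l} => (⟨s.1, h2 s.1 s.2⟩ : {x // x ∈ S})) =
        Subtype.val := rfl
      rw [this, List.attach_map_subtype_val, h3]
      simp

theorem PL.comap {A : Type*} [Group A] {ℓ : Γ → ℕ} (h : PL ℓ) (f : A →* Γ)
    (hf : Function.Injective f) : PL (fun a => ℓ (f a)) where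
  one := by simp [h.one]
  inv g := by simp [h.inv]
  mul g k := by simpa using h.mul (f g) (f k)
  fin r := (h.fin r).preimage hf.injOn

end WordLength

section Iso

universe u v

/-- The two factors as a family of groups in a common universe. -/
def Fam (A : Type u) (B : Type v) : Bool → Type (max u v)
  | true => ULift.{v} A
  | false => ULift.{u} B

instance famGroup (A : Type u) (B : Type v) [Group A] [Group B] : ∀ i, Group (Fam A B i)
  | true => inferInstanceAs (Group (ULift.{v} A))
  | false => inferInstanceAs (Group (ULift.{u} B))

variable {A : Type u} {B : Type v} {C : Type*} [Group A] [Group B] [Group C]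

/-- The inclusion of the first factor. -/
def famA (A : Type u) (B : Type v) [Group A] [Group B] : A ≃* Fam A B true :=
  (MulEquiv.ulift : ULift.{v} A ≃* A).symm

/-- The inclusion of the second factor. -/
def famB (A : Type u) (B : Type v) [Group A] [Group B] : B ≃* Fam A B false :=
  (MulEquiv.ulift : ULift.{u} B ≃* B).symm

/-- The maps from the base group. -/
def famMap (ja : C →* A) (jb : C →* B) : ∀ i, C →* Fam A B i
  | true => (famA A B).toMonoidHom.comp ja
  | false => (famB A B).toMonoidHom.comp jb

/-- From the amalgam to the pushout. -/
def toPush (ja : C →* A) (jb : C →* B) : AmalgamatedProduct ja jb →* PushoutI (famMap ja jb) :=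
  QuotientGroup.lift _ (Coprod.lift
    ((PushoutI.of (φ := famMap ja jb) true).comp (famA A B).toMonoidHom)
    ((PushoutI.of (φ := famMap ja jb) false).comp (famB A B).toMonoidHom)) (by
      refine Subgroup.normalClosure_le_normal ?_
      rintro x ⟨c, rfl⟩
      have h1 := PushoutI.of_apply_eq_base (famMap ja jb) true c
      have h2 := PushoutI.of_apply_eq_base (famMap ja jb) false c
      have h1' : PushoutI.of (φ := famMap ja jb) true (famA A B (ja c)) = PushoutI.base _ c := h1
      have h2' : PushoutI.of (φ := famMap ja jb) false (famB A B (jb c)) = PushoutI.base _ c := h2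
      simp [MonoidHom.mem_ker, h1', h2'])

/-- The quotient map onto the amalgam. -/
def mkAmalg (ja : C →* A) (jb : C →* B) : Coprod A B →* AmalgamatedProduct ja jb :=
  QuotientGroup.mk' _

theorem mkAmalg_rel (ja : C →* A) (jb : C →* B) (c : C) :
    mkAmalg ja jb (Coprod.inl (ja c)) = mkAmalg ja jb (Coprod.inr (jb c)) := by
  rw [← mul_inv_eq_one, ← map_inv, ← map_mul]
  exact (QuotientGroup.eq_one_iff _).2 (Subgroup.subset_normalClosure ⟨c, rfl⟩)

/-- From the pushout factors to the amalgam. -/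
def famToAmalg (ja : C →* A) (jb : C →* B) : ∀ i, Fam A B i →* AmalgamatedProduct ja jb
  | true => ((mkAmalg ja jb).comp Coprod.inl).comp (famA A B).symm.toMonoidHom
  | false => ((mkAmalg ja jb).comp Coprod.inr).comp (famB A B).symm.toMonoidHom

/-- From the pushout to the amalgam. -/
def ofPush (ja : C →* A) (jb : C →* B) : PushoutI (famMap ja jb) →* AmalgamatedProduct ja jb :=
  PushoutI.lift (famToAmalg ja jb) ((mkAmalg ja jb).comp (Coprod.inl.comp ja)) (by
    rintro (_ | _)
    · ext c
      exact (mkAmalg_rel ja jb c).symm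
    · ext c
      rfl)

theorem toPush_inl (ja : C →* A) (jb : C →* B) (a : A) :
    toPush ja jb (mkAmalg ja jb (Coprod.inl a)) =
      PushoutI.of (φ := famMap ja jb) true (famA A B a) :=
  Coprod.lift_apply_inl ((PushoutI.of (φ := famMap ja jb) true).comp (famA A B).toMonoidHom)
    ((PushoutI.of (φ := famMap ja jb) false).comp (famB A B).toMonoidHom) a

theorem toPush_inr (ja : C →* A) (jb : C →* B) (b : B) :
    toPush ja jb (mkAmalg ja jb (Coprod.inr b)) =
      PushoutI.of (φ := famMap ja jb) false (famB A B b) :=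
  Coprod.lift_apply_inr ((PushoutI.of (φ := famMap ja jb) true).comp (famA A B).toMonoidHom)
    ((PushoutI.of (φ := famMap ja jb) false).comp (famB A B).toMonoidHom) b

theorem ofPush_toPush (ja : C →* A) (jb : C →* B) (x : AmalgamatedProduct ja jb) :
    ofPush ja jb (toPush ja jb x) = x := by
  obtain ⟨x, rfl⟩ : ∃ y, mkAmalg ja jb y = x := QuotientGroup.mk'_surjective _ x
  have : ((ofPush ja jb).comp (toPush ja jb)).comp (mkAmalg ja jb) = mkAmalg ja jb := by
    ext a
    · change ofPush ja jb (toPush ja jb (mkAmalg ja jb (Coprod.inl a))) = _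
      rw [toPush_inl]
      exact PushoutI.lift_of _ _ _ _
    · change ofPush ja jb (toPush ja jb (mkAmalg ja jb (Coprod.inr a))) = _
      rw [toPush_inr]
      exact PushoutI.lift_of _ _ _ _
  exact DFunLike.congr_fun this x

theorem toPush_ofPush (ja : C →* A) (jb : C →* B) (x : PushoutI (famMap ja jb)) :
    toPush ja jb (ofPush ja jb x) = x := by
  have : (toPush ja jb).comp (ofPush ja jb) = MonoidHom.id _ := by
    refine PushoutI.hom_ext_nonempty ?_
    rintro (_ | _)
    · ext b
      change toPush ja jb (ofPush ja jb (PushoutI.of false b)) = PushoutI.of false b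
      unfold ofPush
      rw [PushoutI.lift_of]
      change toPush ja jb (mkAmalg ja jb (Coprod.inr ((famB A B).symm b))) = _
      rw [toPush_inr, MulEquiv.apply_symm_apply]
    · ext b
      change toPush ja jb (ofPush ja jb (PushoutI.of true b)) = PushoutI.of true b
      unfold ofPush
      rw [PushoutI.lift_of]
      change toPush ja jb (mkAmalg ja jb (Coprod.inl ((famA A B).symm b))) = _
      rw [toPush_inl, MulEquiv.apply_symm_apply]
  exact DFunLike.congr_fun this x

theorem nmet_left {X : Type*} [Group X] {ℓ : X → ℕ} (h : PL ℓ) :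
    NMet (fun a b => ℓ (a⁻¹ * b)) := by
  refine ⟨fun x => by simp [h.one], fun x y => ?_, fun x y z => ?_⟩
  · rw [← h.inv (x⁻¹ * y)]; simp
  · have := h.mul (x⁻¹ * y) (y⁻¹ * z)
    simpa [mul_assoc] using this

theorem factor_AD {A A' : Type*} [Group A] [Group A'] (e : A ≃* A') (n : ℕ)
    (hA : ∃ SA : Finset A, Subgroup.closure (SA : Set A) = ⊤ ∧ (∀ s ∈ SA, s⁻¹ ∈ SA) ∧
      ASDimLEdist (fun a b : A => (wordDist (SA : Set A) a b : ℝ)) n) :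
    ∃ ℓA : A' → ℕ, PL ℓA ∧ AD (fun a b => ℓA (a⁻¹ * b)) Set.univ n := by
  obtain ⟨S, h1, h2, h3⟩ := hA
  have hPL := wordLength_PL S h1 h2
  refine ⟨fun a => wordDist (S : Set A) 1 (e.symm a), hPL.comap e.symm.toMonoidHom e.symm.injective, ?_⟩
  have h4 : AD (fun a b => wordDist (S : Set A) 1 (a⁻¹ * b)) Set.univ n := by
    refine AD.of_asdim (nmet_left hPL) ?_
    simpa only [← wordDist_eq] using h3
  refine AD.comap (d := fun a b => wordDist (S : Set A) 1 (a⁻¹ * b)) ?_ h4 e.symm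
    (fun _ _ => trivial) (fun r => ⟨r, fun x _ y _ h => ?_⟩) (fun r => ⟨r, fun x _ y _ h => ?_⟩)
  · exact nmet_left (hPL.comap e.symm.toMonoidHom e.symm.injective)
  · simpa using h
  · simpa using h

end Iso

end AsdimAmalg

/-- If `A` and `B` are finitely generated groups with `asdim A ≤ n` and `asdim B ≤ n`,
and `C` is a common finitely generated subgroup, then `asdim (A ∗_C B) ≤ n + 1` (with
respect to any word metric on the amalgamated product). -/
theorem asdim_amalgamated_product_le {A B C : Type*} [Group A] [Group B] [Group C]
    (ja : C →* A) (jb : C →* B)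
    (hja : Function.Injective ja) (hjb : Function.Injective jb)
    (hC : Group.FG C) (n : ℕ)
    (hA : ∃ SA : Finset A, Subgroup.closure (SA : Set A) = ⊤ ∧ (∀ s ∈ SA, s⁻¹ ∈ SA) ∧
      ASDimLEdist (fun a b : A => (wordDist (SA : Set A) a b : ℝ)) n)
    (hB : ∃ SB : Finset B, Subgroup.closure (SB : Set B) = ⊤ ∧ (∀ s ∈ SB, s⁻¹ ∈ SB) ∧
      ASDimLEdist (fun a b : B => (wordDist (SB : Set B) a b : ℝ)) n) :
    ∀ S : Finset (AmalgamatedProduct ja jb),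
      Subgroup.closure (S : Set (AmalgamatedProduct ja jb)) = ⊤ →
      (∀ s ∈ S, s⁻¹ ∈ S) →
      ASDimLEdist
        (fun a b : AmalgamatedProduct ja jb =>
          (wordDist (S : Set (AmalgamatedProduct ja jb)) a b : ℝ)) (n + 1) := by
  intro S hS hinv
  have hPL := AsdimAmalg.wordLength_PL S hS hinv
  have hinj : Function.Injective (AsdimAmalg.ofPush ja jb) :=
    Function.LeftInverse.injective (AsdimAmalg.toPush_ofPush ja jb)
  have hℓ := hPL.comap (AsdimAmalg.ofPush ja jb) hinj
  have hmain := AsdimAmalg.pushout_main (AsdimAmalg.famMap ja jb) (by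
    rintro (_ | _)
    · exact (AsdimAmalg.famB A B).injective.comp hjb
    · exact (AsdimAmalg.famA A B).injective.comp hja) n (by
    rintro (_ | _)
    · exact AsdimAmalg.factor_AD (AsdimAmalg.famB A B) n hB
    · exact AsdimAmalg.factor_AD (AsdimAmalg.famA A B) n hA) hℓ
  have hd : AsdimAmalg.NMet (wordDist (S : Set (AmalgamatedProduct ja jb))) := by
    refine ⟨fun x => ?_, fun x y => ?_, fun x y z => ?_⟩
    · rw [AsdimAmalg.wordDist_eq]
      simpa using hPL.one
    · rw [AsdimAmalg.wordDist_eq, AsdimAmalg.wordDist_eq _ y x, ← hPL.inv (x⁻¹ * y)]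
      simp
    · rw [AsdimAmalg.wordDist_eq, AsdimAmalg.wordDist_eq _ x y, AsdimAmalg.wordDist_eq _ y z]
      have := hPL.mul (x⁻¹ * y) (y⁻¹ * z)
      simpa [mul_assoc] using this
  refine AsdimAmalg.AD.to_asdim hd ?_
  have key : ∀ x y, AsdimAmalg.rd (fun a => wordDist (S : Set (AmalgamatedProduct ja jb)) 1
      (AsdimAmalg.ofPush ja jb a)) (AsdimAmalg.toPush ja jb x⁻¹) (AsdimAmalg.toPush ja jb y⁻¹) =
      wordDist (S : Set (AmalgamatedProduct ja jb)) x y := by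
    intro x y
    rw [AsdimAmalg.wordDist_eq _ x y]
    unfold AsdimAmalg.rd
    beta_reduce
    simp only [map_mul, map_inv, AsdimAmalg.ofPush_toPush, inv_inv]
  refine AsdimAmalg.AD.comap hd hmain (fun x => AsdimAmalg.toPush ja jb x⁻¹)
    (fun _ _ => trivial) (fun r => ⟨r, fun x _ y _ h => ?_⟩) (fun r => ⟨r, fun x _ y _ h => ?_⟩)
  · exact (key x y).le.trans h
  · exact (key x y).ge.trans h
end

section
/- If G is a finitely generated group with asdim G ≤ n and φ : H → H' is an isomorphism between two finitely generated subgroups of G, then the HNN extension G∗_φ satisfies asdim(G∗_φ) ≤ n + 1. -/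
open Set

/-- A graph-like integer distance. -/
structure IsGD {X : Type*} (d : X → X → ℕ) : Prop where
  self : ∀ x, d x x = 0
  eq : ∀ x y, d x y = 0 → x = y
  symm : ∀ x y, d x y = d y x
  tri : ∀ x y z, d x z ≤ d x y + d y z
  geo : ∀ x y k, d x y ≤ k + 1 → ∃ z, d x z ≤ k ∧ d z y ≤ 1

/-- `A` is covered by `n+1` coloured, `r`-disjoint, `D`-bounded families. -/
def Col {X : Type*} (d : X → X → ℕ) (n : ℕ) (A : Set X) (r D : ℕ) : Prop :=
  ∃ c : X → Fin (n + 1), ∃ s : X → Set X,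
    (∀ x ∈ A, ∀ y ∈ A, c x = c y → d x y ≤ r → s x = s y) ∧
    (∀ x ∈ A, ∀ y ∈ A, c x = c y → s x = s y → d x y ≤ D)

theorem Col.of_label {X Λ : Type*} {d : X → X → ℕ} {n : ℕ} {A : Set X} {r D : ℕ}
    (c : X → Fin (n + 1)) (s : X → Λ)
    (h1 : ∀ x ∈ A, ∀ y ∈ A, c x = c y → d x y ≤ r → s x = s y)
    (h2 : ∀ x ∈ A, ∀ y ∈ A, c x = c y → s x = s y → d x y ≤ D) : Col d n A r D := by
  refine ⟨c, fun x => {y | s y = s x}, ?_, ?_⟩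
  · intro x hx y hy hc hd
    simp only [h1 x hx y hy hc hd]
  · intro x hx y hy hc hs
    apply h2 x hx y hy hc
    have : x ∈ {z | s z = s x} := rfl
    simp only at hs
    rw [hs] at this
    exact this

theorem Col.mono {X : Type*} {d : X → X → ℕ} {n : ℕ} {A A' : Set X} {r r' D D' : ℕ}
    (h : Col d n A r D) (hA : A' ⊆ A) (hr : r' ≤ r) (hD : D ≤ D') : Col d n A' r' D' := by
  obtain ⟨c, s, h1, h2⟩ := h
  exact ⟨c, s, fun x hx y hy hc hd => h1 x (hA hx) y (hA hy) hc (hd.trans hr),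
    fun x hx y hy hc hs => (h2 x (hA hx) y (hA hy) hc hs).trans hD⟩

theorem Col.nbhd {X : Type*} {d : X → X → ℕ} (hd : IsGD d) {n : ℕ} {B : Set X} {r s D : ℕ}
    (h : Col d n B (r + 2 * s) D) :
    Col d n {x | ∃ y ∈ B, d x y ≤ s} r (D + 2 * s) := by
  classical
  obtain ⟨c, l, h1, h2⟩ := h
  have : ∀ x, ∃ y, (∃ y ∈ B, d x y ≤ s) → y ∈ B ∧ d x y ≤ s := by
    intro x
    by_cases hx : ∃ y ∈ B, d x y ≤ s
    · obtain ⟨y, hy⟩ := hx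
      exact ⟨y, fun _ => hy⟩
    · exact ⟨x, fun h => absurd h hx⟩
  choose b hb using this
  refine ⟨c ∘ b, l ∘ b, ?_, ?_⟩
  · intro x hx y hy hc hxy
    obtain ⟨hx1, hx2⟩ := hb x hx
    obtain ⟨hy1, hy2⟩ := hb y hy
    apply h1 _ hx1 _ hy1 hc
    have e1 := hd.tri (b x) x (b y)
    have e2 := hd.tri x y (b y)
    have e3 := hd.symm (b x) x
    omega
  · intro x hx y hy hc hxy
    obtain ⟨hx1, hx2⟩ := hb x hx
    obtain ⟨hy1, hy2⟩ := hb y hy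
    have := h2 _ hx1 _ hy1 hc hxy
    have e1 := hd.tri x (b x) y
    have e2 := hd.tri (b x) (b y) y
    have e3 := hd.symm (b y) y
    omega

theorem Col.disj {X I : Type*} {d : X → X → ℕ} {n : ℕ} {A : Set X} {r D : ℕ}
    (p : X → I) (h : ∀ i, Col d n {x | x ∈ A ∧ p x = i} r D)
    (hp : ∀ x ∈ A, ∀ y ∈ A, d x y ≤ r → p x = p y) : Col d n A r D := by
  choose c s h1 h2 using h
  refine Col.of_label (fun x => c (p x) x) (fun x => (p x, s (p x) x)) ?_ ?_
  · intro x hx y hy hc hxy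
    have e := hp x hx y hy hxy
    have := h1 (p x) x ⟨hx, rfl⟩ y ⟨hy, e.symm⟩ (by simpa only [← e] using hc) hxy
    simp only [← e, this]
  · intro x hx y hy hc hs
    simp only [Prod.mk.injEq] at hs
    obtain ⟨e, hs⟩ := hs
    exact h2 (p x) x ⟨hx, rfl⟩ y ⟨hy, e.symm⟩ (by simpa only [← e] using hc)
      (by simpa only [← e] using hs)

theorem Col.union {X : Type*} {d : X → X → ℕ} (hd : IsGD d) {n : ℕ} {A B : Set X}
    {r D0 D1 : ℕ} (hA : Col d n A r D0) (hB : Col d n B (2 * r + D0) D1) :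
    Col d n (A ∪ B) r (D1 + 2 * (D0 + r) + D0) := by
  classical
  obtain ⟨c0, s0, hA1, hA2⟩ := hA
  obtain ⟨c1, s1, hB1, hB2⟩ := hB
  let N : X → X → Prop := fun x y => y ∈ B ∧ c1 y = c0 x ∧
    ∃ x' ∈ A, c0 x' = c0 x ∧ s0 x' = s0 x ∧ d x' y ≤ r
  have hNu : ∀ x y x' y', c0 x = c0 x' → s0 x = s0 x' → N x y → N x' y' → s1 y = s1 y' := by
    rintro x y x' y' hc hs ⟨hy, hcy, z, hz, hcz, hsz, hzy⟩ ⟨hy', hcy', z', hz', hcz', hsz', hzy'⟩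
    apply hB1 _ hy _ hy'
    · rw [hcy, hcy', hc]
    · have e0 := hA2 z hz z' hz' (by rw [hcz, hcz', hc]) (by rw [hsz, hsz', hs])
      have e1 := hd.tri y z y'
      have e2 := hd.tri z z' y'
      have e3 := hd.symm z y
      omega
  have hch : ∀ x, ∃ y, (∃ y, N x y) → N x y := by
    intro x
    by_cases hx : ∃ y, N x y
    · obtain ⟨y, hy⟩ := hx
      exact ⟨y, fun _ => hy⟩
    · exact ⟨x, fun h => absurd h hx⟩
  choose b hb using hch
  let c : X → Fin (n + 1) := fun x => if x ∈ B then c1 x else c0 x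
  let s : X → Set X ⊕ Set X := fun x =>
    if x ∈ B then Sum.inl (s1 x) else
      if ∃ y, N x y then Sum.inl (s1 (b x)) else Sum.inr (s0 x)
  have cB : ∀ x, x ∈ B → c x = c1 x := fun x hx => if_pos hx
  have cA : ∀ x, x ∉ B → c x = c0 x := fun x hx => if_neg hx
  have sB : ∀ x, x ∈ B → s x = Sum.inl (s1 x) := fun x hx => if_pos hx
  have sA : ∀ x, x ∉ B → (∃ y, N x y) → s x = Sum.inl (s1 (b x)) := by
    intro x hx h
    simp only [s, if_neg hx, if_pos h]
  have sA' : ∀ x, x ∉ B → (¬ ∃ y, N x y) → s x = Sum.inr (s0 x) := by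
    intro x hx h
    simp only [s, if_neg hx, if_neg h]
  have mixed : ∀ x ∈ A, x ∉ B → ∀ y ∈ B, c x = c y → d x y ≤ r → s x = s y := by
    intro x hxA hx y hy hc hxy
    rw [cA x hx, cB y hy] at hc
    have hN : N x y := ⟨hy, hc.symm, x, hxA, rfl, rfl, hxy⟩
    rw [sA x hx ⟨y, hN⟩, sB y hy, hNu x (b x) x y rfl rfl (hb x ⟨y, hN⟩) hN]
  -- anchors
  have anchor : ∀ x ∈ A ∪ B, ∀ l, s x = Sum.inl l →
      ∃ z ∈ B, c1 z = c x ∧ s1 z = l ∧ d x z ≤ D0 + r := by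
    intro x hx l hl
    by_cases hxB : x ∈ B
    · rw [sB x hxB] at hl
      exact ⟨x, hxB, (cB x hxB).symm, Sum.inl.inj hl, by rw [hd.self]; omega⟩
    · have hxA : x ∈ A := hx.resolve_right hxB
      by_cases hN : ∃ y, N x y
      · rw [sA x hxB hN] at hl
        obtain ⟨h1, h2, z, hz, hcz, hsz, hzr⟩ := hb x hN
        refine ⟨b x, h1, by rw [h2, cA x hxB], Sum.inl.inj hl, ?_⟩
        have e1 := hd.tri x z (b x)
        have e2 := hA2 x hxA z hz hcz.symm hsz.symm
        omega
      · rw [sA' x hxB hN] at hl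
        cases hl
  refine Col.of_label c s ?_ ?_
  · intro x hx y hy hc hxy
    by_cases hxB : x ∈ B <;> by_cases hyB : y ∈ B
    · rw [sB x hxB, sB y hyB]
      rw [cB x hxB, cB y hyB] at hc
      rw [hB1 x hxB y hyB hc (by omega)]
    · exact (mixed y (hy.resolve_right hyB) hyB x hxB hc.symm (by rw [hd.symm]; exact hxy)).symm
    · exact mixed x (hx.resolve_right hxB) hxB y hyB hc hxy
    · have hxA := hx.resolve_right hxB
      have hyA := hy.resolve_right hyB
      rw [cA x hxB, cA y hyB] at hc
      have hs := hA1 x hxA y hyA hc hxy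
      have hNN : ∀ z, N x z ↔ N y z := by
        intro z
        simp only [N, hc, hs]
      by_cases hN : ∃ z, N x z
      · have hN' : ∃ z, N y z := by simpa only [hNN] using hN
        rw [sA x hxB hN, sA y hyB hN', hNu x (b x) y (b y) hc hs (hb x hN) (hb y hN')]
      · have hN' : ¬ ∃ z, N y z := by simpa only [hNN] using hN
        rw [sA' x hxB hN, sA' y hyB hN', hs]
  · intro x hx y hy hc hs
    rcases hl : s x with l | l
    · obtain ⟨z, hz, hcz, hsz, hxz⟩ := anchor x hx l hl
      obtain ⟨w, hw, hcw, hsw, hyw⟩ := anchor y hy l (hs ▸ hl)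
      have e0 := hB2 z hz w hw (by rw [hcz, hcw, hc]) (by rw [hsz, hsw])
      have e1 := hd.tri x z y
      have e2 := hd.tri z w y
      have e3 := hd.symm y w
      omega
    · have key : ∀ x ∈ A ∪ B, s x = Sum.inr l → x ∈ A ∧ x ∉ B ∧ s0 x = l := by
        intro x hx hl
        by_cases hxB : x ∈ B
        · rw [sB x hxB] at hl
          cases hl
        · by_cases hN : ∃ y, N x y
          · rw [sA x hxB hN] at hl
            cases hl
          · rw [sA' x hxB hN] at hl
            exact ⟨hx.resolve_right hxB, hxB, Sum.inr.inj hl⟩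
      obtain ⟨a1, a2, a3⟩ := key x hx hl
      obtain ⟨b1, b2, b3⟩ := key y hy (hs ▸ hl)
      rw [cA x a2, cA y b2] at hc
      have := hA2 x a1 y b1 hc (by rw [a3, b3])
      omega

/-- Multiplicity to colours. -/
theorem Col.of_mult {X Λ : Type*} {d : X → X → ℕ} (hd : IsGD d) {m r D : ℕ} (L : X → Λ)
    (hL : ∀ x y, L x = L y → d x y ≤ D)
    (hm : ∀ x, ∃ ψ : X → Fin (m + 1), ∀ y z, d x y ≤ (m + 1) * r → d x z ≤ (m + 1) * r →
      ψ y = ψ z → L y = L z) :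
    Col d m univ r (D + (m + 1) * r) := by
  classical
  let N : ℕ → X → Set Λ := fun j x => {l | ∃ y, d x y ≤ j * r ∧ L y = l}
  have hmono : ∀ x i j, i ≤ j → N i x ⊆ N j x := by
    rintro x i j hij l ⟨y, hy, rfl⟩
    exact ⟨y, hy.trans (Nat.mul_le_mul_right r hij), rfl⟩
  have hfin : ∀ x, (N (m + 1) x).Finite ∧ (N (m + 1) x).ncard ≤ m + 1 := by
    intro x
    obtain ⟨ψ, hψ⟩ := hm x
    let f : Fin (m + 1) → Λ := fun i =>
      if h : ∃ y, d x y ≤ (m + 1) * r ∧ ψ y = i then L h.choose else L x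
    have hsub : N (m + 1) x ⊆ Set.range f := by
      rintro l ⟨y, hy, rfl⟩
      refine ⟨ψ y, ?_⟩
      have h : ∃ z, d x z ≤ (m + 1) * r ∧ ψ z = ψ y := ⟨y, hy, rfl⟩
      simp only [f, dif_pos h]
      exact hψ _ _ h.choose_spec.1 hy h.choose_spec.2
    refine ⟨(Set.finite_range f).subset hsub, ?_⟩
    refine (Set.ncard_le_ncard hsub (Set.finite_range f)).trans ?_
    rw [← Set.image_univ]
    refine (Set.ncard_image_le Set.finite_univ).trans ?_
    simp [Set.ncard_univ]
  have hst : ∀ x, ∃ j, j ≤ m ∧ N j x = N (j + 1) x := by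
    intro x
    by_contra! hcon
    have : ∀ j, j ≤ m + 1 → j + 1 ≤ (N j x).ncard := by
      intro j
      induction j with
      | zero =>
        intro _
        have hf : (N 0 x).Finite := (hfin x).1.subset (hmono x _ _ (by omega))
        have : (N 0 x).Nonempty := ⟨L x, x, by simp [hd.self], rfl⟩
        have := (Set.ncard_pos hf).2 this
        omega
      | succ j ih =>
        intro hj
        have h1 := ih (by omega)
        have hf : (N (j + 1) x).Finite := (hfin x).1.subset (hmono x _ _ hj)
        have hss : N j x ⊂ N (j + 1) x :=
          (hmono x j (j + 1) (by omega)).ssubset_of_ne (hcon j (by omega))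
        have := Set.ncard_lt_ncard hss hf
        omega
    have h1 := this (m + 1) le_rfl
    have h2 := (hfin x).2
    omega
  choose j hj hjN using hst
  have hbd : ∀ x, (N (j x) x).ncard ≤ m + 1 := fun x =>
    (Set.ncard_le_ncard (hmono x _ _ (by have := hj x; omega)) (hfin x).1).trans (hfin x).2
  have hfj : ∀ x, (N (j x) x).Finite := fun x =>
    (hfin x).1.subset (hmono x _ _ (by have := hj x; omega))
  have hpos : ∀ x, 0 < (N (j x) x).ncard := fun x =>
    (Set.ncard_pos (hfj x)).2 ⟨L x, x, by simp [hd.self], rfl⟩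
  have hstep : ∀ x y i, d x y ≤ r → N i x ⊆ N (i + 1) y := by
    rintro x y i hxy l ⟨z, hz, rfl⟩
    refine ⟨z, ?_, rfl⟩
    have e1 := hd.tri y x z
    have e2 := hd.symm x y
    rw [Nat.succ_mul]
    omega
  have main : ∀ x y, j x ≤ j y → (N (j x) x).ncard = (N (j y) y).ncard → d x y ≤ r →
      N (j x) x = N (j y) y := by
    intro x y hxy hc hdxy
    apply Set.eq_of_subset_of_ncard_le _ hc.ge (hfj y)
    rw [hjN y]
    exact (hstep x y _ hdxy).trans (hmono y _ _ (by omega))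
  refine Col.of_label (fun x => ⟨(N (j x) x).ncard - 1, by have := hbd x; omega⟩)
    (fun x => N (j x) x) ?_ ?_
  · intro x _ y _ hc hxy
    have hc' : (N (j x) x).ncard = (N (j y) y).ncard := by
      have := congrArg Fin.val hc
      have h1 := hpos x
      have h2 := hpos y
      simp only at this
      omega
    rcases le_total (j x) (j y) with h | h
    · exact main x y h hc' hxy
    · exact (main y x h hc'.symm (by rw [hd.symm]; exact hxy)).symm
  · intro x _ y _ _ hs
    have : L x ∈ N (j x) x := ⟨x, by simp [hd.self], rfl⟩
    rw [hs] at this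
    obtain ⟨z, hz, hLz⟩ := this
    have e0 := hL x z hLz.symm
    have e1 := hd.tri x z y
    have e2 := hd.symm z y
    have e3 : j y * r ≤ (m + 1) * r := Nat.mul_le_mul_right r (by have := hj y; omega)
    omega

theorem layer_arith {R lam a b h : ℕ} (hlam : 2 * lam < R) (hab : a / (2 * R) < b / (2 * R))
    (hba : b ≤ a + 2 * lam) (h1 : h ≤ a + 2 * lam) (h2 : b ≤ h + 2 * lam) :
    (h + R) / (2 * R) = b / (2 * R) ∧
    (h < 2 * R * (h / (2 * R)) + 2 * lam ∨ 2 * R * (h / (2 * R) + 1) ≤ h + 2 * lam) := by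
  have hR : 0 < 2 * R := by omega
  set k := b / (2 * R) with hk
  have hkb : 2 * R * k ≤ b := Nat.mul_div_le b (2 * R)
  have hak : a < 2 * R * k := by
    rw [Nat.div_lt_iff_lt_mul hR] at hab
    rw [Nat.mul_comm]
    exact hab
  constructor
  · rw [Nat.mul_comm] at hkb hak
    have : (k + 1) * (2 * R) = k * (2 * R) + 2 * R := by ring
    apply Nat.div_eq_of_lt_le <;> omega
  · by_cases hh : 2 * R * k ≤ h
    · left
      have : h / (2 * R) = k := by
        rw [Nat.mul_comm] at hh hak
        have : (k + 1) * (2 * R) = k * (2 * R) + 2 * R := by ring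
        apply Nat.div_eq_of_lt_le <;> omega
      rw [this]
      omega
    · right
      have hk0 : k ≠ 0 := by
        intro h0
        rw [h0] at hak
        simp at hak
      obtain ⟨k', hk'⟩ := Nat.exists_eq_succ_of_ne_zero hk0
      have e : 2 * R * k = 2 * R * k' + 2 * R := by rw [hk']; rw [Nat.mul_succ]
      have : h / (2 * R) = k' := by
        rw [Nat.mul_comm (2 * R) k'] at e
        have : (k' + 1) * (2 * R) = k' * (2 * R) + 2 * R := by ring
        apply Nat.div_eq_of_lt_le <;> omega
      rw [this]
      have : 2 * R * (k' + 1) = 2 * R * k' + 2 * R := by ring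
      omega

theorem low_arith {R h K Q : ℕ} (hQ : Q < R) (hK : h / (2 * R) = K) :
    (h < 2 * R * K + Q → (h + R) / (2 * R) = K) ∧
    (2 * R * (K + 1) ≤ h + Q → (h + R) / (2 * R) = K + 1) := by
  have hR : 0 < 2 * R := by omega
  have h1 : 2 * R * K ≤ h := hK ▸ Nat.mul_div_le h (2 * R)
  have h2 : h < 2 * R * (K + 1) := hK ▸ Nat.lt_mul_div_succ h hR
  have e1 : 2 * R * (K + 1) = K * (2 * R) + 2 * R := by ring
  have e2 : (K + 1) * (2 * R) = K * (2 * R) + 2 * R := by ring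
  have e3 : (K + 1 + 1) * (2 * R) = K * (2 * R) + 2 * R + 2 * R := by ring
  have e4 : 2 * R * K = K * (2 * R) := by ring
  constructor
  · intro h
    apply Nat.div_eq_of_lt_le <;> omega
  · intro h
    apply Nat.div_eq_of_lt_le <;> omega

theorem hurewicz {X : Type*} {d : X → X → ℕ} (hd : IsGD d) (n : ℕ) (h : X → ℕ)
    (hh : ∀ x y, h x ≤ h y + d x y)
    (hlay : ∀ l r, ∃ D, ∀ a, Col d n {x | a ≤ h x ∧ h x ≤ a + l} r D) (r : ℕ) :
    ∃ D, Col d (n + 1) univ r D := by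
  classical
  rcases isEmpty_or_nonempty X with hX | hX
  · exact ⟨0, fun x => 0, fun x => ∅, fun x => isEmptyElim x, fun x => isEmptyElim x⟩
  obtain ⟨lam, hlam⟩ : ∃ lam, lam = (n + 1 + 1) * r := ⟨_, rfl⟩
  obtain ⟨q, hq⟩ : ∃ q, q = 2 * lam + 1 := ⟨_, rfl⟩
  obtain ⟨Q, hQ⟩ : ∃ Q, Q = (n + 1) * q := ⟨_, rfl⟩
  obtain ⟨R, hR⟩ : ∃ R, R = Q + 2 * q := ⟨_, rfl⟩
  let τ : Fin (n + 1) → ℕ := fun i => (i.val + 1) * q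
  have hτQ : ∀ i, τ i ≤ Q := fun i => by
    rw [hQ]; exact Nat.mul_le_mul_right q (by have := i.2; omega)
  have hτq : ∀ i, q ≤ τ i := fun i => Nat.le_mul_of_pos_left q (by omega)
  have hττ : ∀ i j : Fin (n + 1), i < j → τ i + q ≤ τ j := by
    intro i j hij
    have : τ i + q = (i.val + 1 + 1) * q := by simp only [τ]; ring
    rw [this]
    exact Nat.mul_le_mul_right q (by have : i.val < j.val := hij; omega)
  have hRpos : 0 < 2 * R := by omega
  obtain ⟨D0, hD0⟩ := hlay (2 * R) (2 * lam)
  obtain ⟨D1, hD1⟩ := hlay (2 * R) (2 * lam + 2 * D0)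
  let K : X → ℕ := fun x => h x / (2 * R)
  let K' : X → ℕ := fun x => (h x + R) / (2 * R)
  obtain ⟨c0, s0, hU1, hU2⟩ : ∃ c : X → Fin (n + 1), ∃ s : X → Set X,
      (∀ x y, K x = K y → c x = c y → d x y ≤ 2 * lam → s x = s y) ∧
      (∀ x y, K x = K y → c x = c y → s x = s y → d x y ≤ D0) := by
    choose c s h1 h2 using fun k : ℕ => hD0 (2 * R * k)
    have hmem : ∀ x, 2 * R * K x ≤ h x ∧ h x ≤ 2 * R * K x + 2 * R := by
      intro x
      have e1 : 2 * R * K x ≤ h x := Nat.mul_div_le (h x) (2 * R)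
      have e2 : h x < 2 * R * (K x + 1) := Nat.lt_mul_div_succ (h x) hRpos
      rw [Nat.mul_succ] at e2
      omega
    refine ⟨fun x => c (K x) x, fun x => s (K x) x, ?_, ?_⟩
    · intro x y hK hc hxy
      have := h1 (K x) x (hmem x) y (hK ▸ hmem y) (by simpa only [← hK] using hc) hxy
      simpa only [← hK] using this
    · intro x y hK hc hs
      exact h2 (K x) x (hmem x) y (hK ▸ hmem y) (by simpa only [← hK] using hc)
        (by simpa only [← hK] using hs)
  obtain ⟨c1, s1, hW1, hW2⟩ : ∃ c : X → Fin (n + 1), ∃ s : X → Set X,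
      (∀ x y, K' x = K' y → c x = c y → d x y ≤ 2 * lam + 2 * D0 → s x = s y) ∧
      (∀ x y, K' x = K' y → c x = c y → s x = s y → d x y ≤ D1) := by
    choose c s h1 h2 using fun k : ℕ => hD1 (2 * R * k - R)
    have hmem : ∀ x, 2 * R * K' x - R ≤ h x ∧ h x ≤ 2 * R * K' x - R + 2 * R := by
      intro x
      have e1 : 2 * R * K' x ≤ h x + R := Nat.mul_div_le (h x + R) (2 * R)
      have e2 : h x + R < 2 * R * (K' x + 1) := Nat.lt_mul_div_succ (h x + R) hRpos
      rw [Nat.mul_succ] at e2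
      omega
    refine ⟨fun x => c (K' x) x, fun x => s (K' x) x, ?_, ?_⟩
    · intro x y hK hc hxy
      have := h1 (K' x) x (hmem x) y (hK ▸ hmem y) (by simpa only [← hK] using hc) hxy
      simpa only [← hK] using this
    · intro x y hK hc hs
      exact h2 (K' x) x (hmem x) y (hK ▸ hmem y) (by simpa only [← hK] using hc)
        (by simpa only [← hK] using hs)
  let key : X → ℕ × ℕ × Fin (n + 1) × Set X := fun x => (K x, K' x, c0 x, s0 x)
  let rep : X → X := fun x => Function.invFun key (key x)
  have hrep : ∀ x, K (rep x) = K x ∧ K' (rep x) = K' x ∧ c0 (rep x) = c0 x ∧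
      s0 (rep x) = s0 x := by
    intro x
    have : key (rep x) = key x := Function.invFun_eq ⟨x, rfl⟩
    simpa only [key, Prod.mk.injEq] using this
  have hrepd : ∀ x, d x (rep x) ≤ D0 := by
    intro x
    obtain ⟨a, b, c, e⟩ := hrep x
    exact hU2 _ _ a.symm c.symm e.symm
  have hrepeq : ∀ x y, K x = K y → K' x = K' y → c0 x = c0 y → s0 x = s0 y → rep x = rep y := by
    intro x y a b c e
    have : key x = key y := by simp only [key, a, b, c, e]
    simp only [rep, this]
  let mid : X → Prop := fun x => 2 * R * K x + τ (c0 x) ≤ h x ∧ h x + τ (c0 x) < 2 * R * (K x + 1)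
  let L : X → (ℕ × Fin (n + 1) × Set X) ⊕ (ℕ × Fin (n + 1) × Set X) := fun x =>
    if mid x then Sum.inl (K x, c0 x, s0 x) else Sum.inr (K' x, c1 (rep x), s1 (rep x))
  have Lmid : ∀ x, mid x → L x = Sum.inl (K x, c0 x, s0 x) := fun x hx => if_pos hx
  have Lnmid : ∀ x, ¬ mid x → L x = Sum.inr (K' x, c1 (rep x), s1 (rep x)) :=
    fun x hx => if_neg hx
  refine ⟨_, Col.of_mult (D := D0 + D1 + 2 * D0) hd L ?_ ?_⟩
  · intro x y hL
    by_cases hx : mid x <;> by_cases hy : mid y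
    · rw [Lmid x hx, Lmid y hy] at hL
      simp only [Sum.inl.injEq, Prod.mk.injEq] at hL
      have := hU2 x y hL.1 hL.2.1 hL.2.2
      omega
    · rw [Lmid x hx, Lnmid y hy] at hL
      cases hL
    · rw [Lnmid x hx, Lmid y hy] at hL
      cases hL
    · rw [Lnmid x hx, Lnmid y hy] at hL
      simp only [Sum.inr.injEq, Prod.mk.injEq] at hL
      have e0 := hW2 (rep x) (rep y) (by rw [(hrep x).2.1, (hrep y).2.1, hL.1]) hL.2.1 hL.2.2
      have e1 := hd.tri x (rep x) y
      have e2 := hd.tri (rep x) (rep y) y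
      have e3 := hd.symm y (rep y)
      have e4 := hrepd x
      have e5 := hrepd y
      omega
  · intro x0
    rw [← hlam]
    have hball : ∀ y z, d x0 y ≤ lam → d x0 z ≤ lam → d y z ≤ 2 * lam := by
      intro y z hy hz
      have e1 := hd.tri y x0 z
      have e2 := hd.symm y x0
      omega
    have hhb : ∀ y z, d x0 y ≤ lam → d x0 z ≤ lam → h y ≤ h z + 2 * lam := by
      intro y z hy hz
      have := hh y z
      have := hball y z hy hz
      omega
    by_cases hcase : ∃ a b, d x0 a ≤ lam ∧ d x0 b ≤ lam ∧ K a < K b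
    · obtain ⟨a, b, ha, hb, hab⟩ := hcase
      have hall : ∀ z, d x0 z ≤ lam → K' z = K b ∧ ¬ mid z := by
        intro z hz
        obtain ⟨h1, h2⟩ := layer_arith (R := R) (lam := lam) (h := h z) (by omega) hab
          (hhb b a hb ha) (hhb z a hz ha) (hhb b z hb hz)
        refine ⟨h1, ?_⟩
        rintro ⟨m1, m2⟩
        have := hτq (c0 z)
        simp only [K] at m1 m2
        omega
      refine ⟨fun y => Fin.castSucc (c1 (rep y)), ?_⟩
      intro y z hy hz hψ
      have hψ' : c1 (rep y) = c1 (rep z) := Fin.castSucc_injective _ hψ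
      obtain ⟨k1, m1⟩ := hall y hy
      obtain ⟨k2, m2⟩ := hall z hz
      have e0 : s1 (rep y) = s1 (rep z) := by
        apply hW1 _ _ (by rw [(hrep y).2.1, (hrep z).2.1, k1, k2]) hψ'
        have e1 := hd.tri (rep y) y (rep z)
        have e2 := hd.tri y z (rep z)
        have e3 := hd.symm y (rep y)
        have e4 := hrepd y
        have e5 := hrepd z
        have := hball y z hy hz
        omega
      rw [Lnmid y m1, Lnmid z m2, k1, k2, hψ', e0]
    · push Not at hcase
      have hK : ∀ y z, d x0 y ≤ lam → d x0 z ≤ lam → K y = K z := fun y z hy hz =>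
        le_antisymm (hcase z y hz hy) (hcase y z hy hz)
      have hx0 : d x0 x0 ≤ lam := by rw [hd.self]; omega
      have hs0 : ∀ y z, d x0 y ≤ lam → d x0 z ≤ lam → c0 y = c0 z → s0 y = s0 z :=
        fun y z hy hz hc => hU1 y z (hK y z hy hz) hc (hball y z hy hz)
      have hnm : ∀ y z, d x0 y ≤ lam → d x0 z ≤ lam → c0 y = c0 z → ¬ mid y → ¬ mid z →
          L y = L z := by
        intro y z hy hz hc hmy hmz
        have hKK := hK y z hy hz
        have hK'' : K' y = K' z := by
          obtain ⟨a1, a2⟩ := low_arith (R := R) (h := h y) (Q := Q) (by omega) (hKK : K y = K z)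
          obtain ⟨b1, b2⟩ := low_arith (R := R) (h := h z) (Q := Q) (by omega) (rfl : _ = K z)
          have t1 := hτQ (c0 y)
          have t2 := hτQ (c0 z)
          have e1 := hhb y z hy hz
          have e2 := hhb z y hz hy
          have e3 : 2 * R * (K z + 1) = 2 * R * K z + 2 * R := by ring
          simp only [mid, hKK, not_and_or, not_le, not_lt] at hmy hmz
          rcases hmy with hmy | hmy <;> rcases hmz with hmz | hmz
          · exact (a1 (by omega)).trans (b1 (by omega)).symm
          · omega
          · omega
          · exact (a2 (by omega)).trans (b2 (by omega)).symm
        have := hrepeq y z hKK hK'' hc (hs0 y z hy hz hc)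
        rw [Lnmid y hmy, Lnmid z hmz, hK'', this]
      let crit : Fin (n + 1) → Prop := fun i => ∃ y z, d x0 y ≤ lam ∧ d x0 z ≤ lam ∧
        c0 y = i ∧ c0 z = i ∧ mid y ∧ ¬ mid z
      have hcr : ∀ i, crit i → (h x0 ≤ 2 * R * K x0 + τ i + lam ∧ 2 * R * K x0 + τ i ≤ h x0 + lam)
          ∨ (h x0 + τ i ≤ 2 * R * K x0 + 2 * R + lam ∧
            2 * R * K x0 + 2 * R ≤ h x0 + τ i + lam) := by
        rintro i ⟨y, z, hy, hz, cy, cz, my, mz⟩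
        simp only [mid, not_and_or, not_le, not_lt, cy, cz, hK y x0 hy hx0, hK z x0 hz hx0]
          at my mz
        have e3 : 2 * R * (K x0 + 1) = 2 * R * K x0 + 2 * R := by ring
        have d1 := hh x0 y
        have d2 := hh y x0
        have d3 := hh x0 z
        have d4 := hh z x0
        have d5 := hd.symm x0 y
        have d6 := hd.symm x0 z
        omega
      have hcrlt : ∀ i j, crit i → crit j → ¬ i < j := by
        intro i j hi hj hij
        have a1 := hcr i hi
        have a2 := hcr j hj
        have a3 := hττ i j hij
        have a4 := hτQ i
        have a5 := hτQ j
        omega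
      have hcru : ∀ i j, crit i → crit j → i = j := fun i j hi hj =>
        le_antisymm (not_lt.1 (hcrlt j i hj hi)) (not_lt.1 (hcrlt i j hi hj))
      refine ⟨fun y => if ¬ mid y ∧ crit (c0 y) then Fin.last (n + 1) else
        Fin.castSucc (c0 y), ?_⟩
      intro y z hy hz hψ
      simp only at hψ
      split_ifs at hψ with h1 h2 h2
      · exact hnm y z hy hz (hcru _ _ h1.2 h2.2) h1.1 h2.1
      · exact absurd hψ.symm (Fin.castSucc_lt_last _).ne
      · exact absurd hψ (Fin.castSucc_lt_last _).ne
      · have hc : c0 y = c0 z := Fin.castSucc_injective _ hψ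
        by_cases my : mid y <;> by_cases mz : mid z
        · rw [Lmid y my, Lmid z mz, hK y z hy hz, hc, hs0 y z hy hz hc]
        · exact absurd ⟨mz, y, z, hy, hz, hc, rfl, my, mz⟩ h2
        · exact absurd ⟨my, z, y, hz, hy, hc.symm, rfl, mz, my⟩ h1
        · exact hnm y z hy hz hc my mz

/-- The suffix of length `m`. -/
def anc {α : Type*} (m : ℕ) (l : List α) : List α := l.drop (l.length - m)

theorem anc_cons {α : Type*} {m : ℕ} {a : α} {l : List α} (h : m ≤ l.length) :
    anc m (a :: l) = anc m l := by
  unfold anc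
  rw [List.length_cons, Nat.succ_sub h, List.drop_succ_cons]

theorem anc_suffix {α : Type*} (m : ℕ) (l : List α) : anc m l <:+ l := List.drop_suffix _ _

theorem anc_length {α : Type*} {m : ℕ} {l : List α} (h : m ≤ l.length) :
    (anc m l).length = m := by
  unfold anc
  rw [List.length_drop]
  omega

theorem anc_self {α : Type*} (l : List α) : anc l.length l = l := by simp [anc]

theorem tree_asdim {X α : Type*} {d : X → X → ℕ} (hd : IsGD d) (n : ℕ) (v : X → List α)
    (hadj : ∀ x y, d x y ≤ 1 → v x = v y ∨ (∃ a, v x = a :: v y) ∨ ∃ a, v y = a :: v x)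
    (hfib : ∀ r, ∃ D, ∀ l, Col d n {x | v x = l} r D) (r : ℕ) :
    ∃ D, Col d (n + 1) univ r D := by
  have hlen : ∀ x y, d x y ≤ 1 → (v x).length ≤ (v y).length + 1 := by
    intro x y h
    rcases hadj x y h with h | ⟨a, h⟩ | ⟨a, h⟩
    · rw [h]; omega
    · rw [h]; simp
    · rw [h]; simp; omega
  have hanc : ∀ x y m, d x y ≤ 1 → m ≤ (v x).length → m ≤ (v y).length →
      anc m (v x) = anc m (v y) := by
    intro x y m h hx hy
    rcases hadj x y h with h | ⟨a, h⟩ | ⟨a, h⟩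
    · rw [h]
    · rw [h, anc_cons hy]
    · rw [h, anc_cons hx]
  have hlip' : ∀ k x y, d x y ≤ k → (v x).length ≤ (v y).length + k := by
    intro k
    induction k with
    | zero =>
      intro x y h
      rw [hd.eq x y (by omega)]; omega
    | succ k ih =>
      intro x y h
      obtain ⟨z, h1, h2⟩ := hd.geo x y k h
      have := ih x z h1
      have := hlen z y h2
      omega
  have hlip : ∀ x y, (v x).length ≤ (v y).length + d x y := fun x y => hlip' _ x y le_rfl
  -- truncated subtrees
  have hT : ∀ l r, ∃ D, ∀ c : List α,
      Col d n {x | c <:+ v x ∧ (v x).length ≤ c.length + l} r D := by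
    intro l
    induction l with
    | zero =>
      intro r
      obtain ⟨D, hD⟩ := hfib r
      refine ⟨D, fun c => (hD c).mono ?_ le_rfl le_rfl⟩
      rintro x ⟨h1, h2⟩
      exact (h1.eq_of_length_le h2).symm
    | succ l ih =>
      intro r
      obtain ⟨D0, hD0⟩ := hfib r
      obtain ⟨D1, hD1⟩ := ih (2 * r + D0 + 2 * r)
      refine ⟨(D1 + 2 * r) + 2 * (D0 + r) + D0, fun c => ?_⟩
      let T : Set X := {x | c <:+ v x ∧ (v x).length ≤ c.length + l}
      let Y : Set X := {x | ∃ y ∈ T, d x y ≤ r}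
      let S : Set X := {x | c <:+ v x ∧ (v x).length = c.length + l + 1 ∧ x ∉ Y}
      have hY : Col d n Y (2 * r + D0) (D1 + 2 * r) := Col.nbhd hd (hD1 c)
      have hS : Col d n S r D0 := by
        refine Col.disj v (fun i => (hD0 i).mono (fun x hx => hx.2) le_rfl le_rfl) ?_
        rintro x ⟨hx1, hx2, hx3⟩ y ⟨hy1, hy2, hy3⟩ hxy
        have claim : ∀ k, k ≤ r → ∀ z, d x z ≤ k →
            (v x).length ≤ (v z).length ∧ anc (v x).length (v z) = v x := by
          intro k
          induction k with
          | zero =>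
            intro _ z hz
            rw [← hd.eq x z (by omega)]
            exact ⟨le_rfl, anc_self _⟩
          | succ k ihk =>
            intro hk z hz
            obtain ⟨w, hw1, hw2⟩ := hd.geo x z k hz
            obtain ⟨i1, i2⟩ := ihk (by omega) w hw1
            have hzl : (v x).length ≤ (v z).length := by
              by_contra hlt
              have hzw : ∃ a, v w = a :: v z := by
                rcases hadj w z hw2 with h | h | ⟨a, h⟩
                · rw [h] at i1; omega
                · exact h
                · have := congrArg List.length h
                  rw [List.length_cons] at this
                  omega
              obtain ⟨a, ha⟩ := hzw
              have hlw := congrArg List.length ha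
              rw [List.length_cons] at hlw
              have hvw : v w = v x := by
                have e : (v x).length = (v w).length := by omega
                rw [e, anc_self] at i2
                exact i2
              apply hx3
              refine ⟨z, ⟨?_, by omega⟩, by omega⟩
              rw [← hvw, ha, List.suffix_cons_iff] at hx1
              rcases hx1 with h | h
              · have := congrArg List.length h
                rw [List.length_cons] at this
                omega
              · exact h
            refine ⟨hzl, ?_⟩
            rw [← hanc w z _ hw2 i1 hzl, i2]
        obtain ⟨c1, c2⟩ := claim r le_rfl y hxy
        have e : (v x).length = (v y).length := by omega
        rw [e, anc_self] at c2
        exact c2.symm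
      refine (Col.union hd hS hY).mono ?_ le_rfl le_rfl
      rintro x ⟨hx1, hx2⟩
      by_cases hxY : x ∈ Y
      · exact Or.inr hxY
      · left
        refine ⟨hx1, ?_, hxY⟩
        by_contra hne
        exact hxY ⟨x, ⟨hx1, by omega⟩, by rw [hd.self]; omega⟩
  refine hurewicz hd n (fun x => (v x).length) hlip ?_ r
  intro l r
  obtain ⟨D, hD⟩ := hT (l + r) r
  refine ⟨D, fun a => ?_⟩
  refine Col.disj (fun x => anc (a - r) (v x)) (fun i => (hD i).mono ?_ le_rfl le_rfl) ?_
  · rintro x ⟨⟨hx1, hx2⟩, rfl⟩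
    refine ⟨anc_suffix _ _, ?_⟩
    rw [anc_length (by omega)]
    omega
  · rintro x ⟨hx1, hx2⟩ y ⟨hy1, hy2⟩ hxy
    have claim : ∀ k, k ≤ r → ∀ z, d x z ≤ k →
        a - r ≤ (v z).length ∧ anc (a - r) (v z) = anc (a - r) (v x) := by
      intro k
      induction k with
      | zero =>
        intro _ z hz
        rw [← hd.eq x z (by omega)]
        exact ⟨by omega, rfl⟩
      | succ k ihk =>
        intro hk z hz
        obtain ⟨w, hw1, hw2⟩ := hd.geo x z k hz
        obtain ⟨i1, i2⟩ := ihk (by omega) w hw1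
        have hzl : a - r ≤ (v z).length := by
          have := hlip x z
          omega
        exact ⟨hzl, by rw [← hanc w z _ hw2 i1 hzl, i2]⟩
    exact (claim r le_rfl y hxy).2.symm

/-- Every element is a word in `S`. -/
def Gen {Γ : Type*} [Group Γ] (S : Set Γ) : Prop :=
  ∀ g : Γ, ∃ l : List Γ, (∀ s ∈ l, s ∈ S) ∧ l.prod = g

theorem gen_of_closure {Γ : Type*} [Group Γ] {S : Set Γ} (h : Subgroup.closure S = ⊤)
    (hs : ∀ s ∈ S, s⁻¹ ∈ S) : Gen S := by
  intro g
  have hg : g ∈ (Subgroup.closure S).toSubmonoid := by rw [h]; trivial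
  rw [Subgroup.closure_toSubmonoid] at hg
  obtain ⟨l, hl, hp⟩ := Submonoid.exists_list_of_mem_closure hg
  refine ⟨l, fun s hsl => ?_, hp⟩
  rcases hl s hsl with h | h
  · exact h
  · simpa using hs _ h

theorem wordDist_le_iff {Γ : Type*} [Group Γ] {S : Set Γ} (hS : Gen S) (g h : Γ) (k : ℕ) :
    wordDist S g h ≤ k ↔
      ∃ l : List Γ, l.length ≤ k ∧ (∀ s ∈ l, s ∈ S) ∧ l.prod = g⁻¹ * h := by
  constructor
  · intro hk
    obtain ⟨l0, h0⟩ := hS (g⁻¹ * h)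
    have hne : {n : ℕ | ∃ l : List Γ, l.length = n ∧ (∀ s ∈ l, s ∈ S) ∧
        l.prod = g⁻¹ * h}.Nonempty := ⟨_, l0, rfl, h0⟩
    obtain ⟨l, h1, h2⟩ := Nat.sInf_mem hne
    exact ⟨l, by rw [h1]; exact hk, h2⟩
  · rintro ⟨l, h1, h2⟩
    have hm : l.length ∈ {n : ℕ | ∃ l : List Γ, l.length = n ∧ (∀ s ∈ l, s ∈ S) ∧
        l.prod = g⁻¹ * h} := ⟨l, rfl, h2⟩
    exact (Nat.sInf_le hm).trans h1

theorem wordDist_left {Γ : Type*} [Group Γ] (S : Set Γ) (g h : Γ) :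
    wordDist S g h = wordDist S 1 (g⁻¹ * h) := by
  simp [wordDist]

theorem wordDist_isGD {Γ : Type*} [Group Γ] {S : Set Γ} (hS : Gen S)
    (hs : ∀ s ∈ S, s⁻¹ ∈ S) : IsGD (wordDist S) := by
  have hsymm : ∀ x y, wordDist S x y ≤ wordDist S y x := by
    intro x y
    obtain ⟨l, h1, h2, h3⟩ := (wordDist_le_iff hS y x _).1 le_rfl
    rw [wordDist_le_iff hS]
    refine ⟨(l.map (·⁻¹)).reverse, by simpa using h1, ?_, ?_⟩
    · intro s hsl
      simp only [List.mem_reverse, List.mem_map] at hsl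
      obtain ⟨a, ha, rfl⟩ := hsl
      exact hs a (h2 a ha)
    · rw [← List.prod_inv_reverse, h3]
      group
  refine ⟨?_, ?_, fun x y => le_antisymm (hsymm x y) (hsymm y x), ?_, ?_⟩
  · intro x
    have := (wordDist_le_iff hS x x 0).2 ⟨[], by simp, by simp, by simp⟩
    omega
  · intro x y h
    obtain ⟨l, h1, h2, h3⟩ := (wordDist_le_iff hS x y 0).1 h.le
    have : l = [] := List.length_eq_zero_iff.1 (by omega)
    subst this
    simp only [List.prod_nil] at h3
    exact (inv_mul_eq_one.1 h3.symm)
  · intro x y z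
    obtain ⟨l, h1, h2, h3⟩ := (wordDist_le_iff hS x y _).1 le_rfl
    obtain ⟨l', h1', h2', h3'⟩ := (wordDist_le_iff hS y z _).1 le_rfl
    rw [wordDist_le_iff hS]
    refine ⟨l ++ l', by rw [List.length_append]; omega, ?_, ?_⟩
    · intro s hsl
      rcases List.mem_append.1 hsl with h | h
      · exact h2 s h
      · exact h2' s h
    · rw [List.prod_append, h3, h3']
      group
  · intro x y k hk
    obtain ⟨l, h1, h2, h3⟩ := (wordDist_le_iff hS x y _).1 hk
    rcases List.eq_nil_or_concat l with rfl | ⟨l', s, rfl⟩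
    · refine ⟨x, ?_, ?_⟩
      · exact (wordDist_le_iff hS x x k).2 ⟨[], by simp, by simp, by simp⟩
      · exact (wordDist_le_iff hS x y 1).2 ⟨[], by simp, by simp, h3⟩
    · rw [List.length_concat] at h1
      refine ⟨x * l'.prod, ?_, ?_⟩
      · exact (wordDist_le_iff hS _ _ k).2
          ⟨l', by omega, fun a ha => h2 a (by simp [ha]), by group⟩
      · refine (wordDist_le_iff hS _ _ 1).2 ⟨[s], by simp, ?_, ?_⟩
        · intro a ha
          exact h2 a (by simp at ha; simp [ha])
        · rw [List.prod_concat] at h3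
          rw [List.prod_singleton, mul_inv_rev, mul_assoc, ← h3]
          group

theorem ball_finite {Γ : Type*} [Group Γ] {S : Set Γ} (hS : Gen S) (hf : S.Finite) (r : ℕ) :
    {g : Γ | wordDist S 1 g ≤ r}.Finite := by
  have : Finite S := hf
  refine ((List.finite_length_le S r).image (fun l => (l.map Subtype.val).prod)).subset ?_
  intro g hg
  obtain ⟨l, h1, h2, h3⟩ := (wordDist_le_iff hS 1 g r).1 hg
  lift l to List S using h2
  refine ⟨l, by simpa using h1, ?_⟩
  simpa using h3

theorem ball_bound {Γ : Type*} {F : Set Γ} (hF : F.Finite) (f : Γ → ℕ) :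
    ∃ r', ∀ a ∈ F, f a ≤ r' := by
  obtain ⟨b, hb⟩ := (hF.image f).bddAbove
  exact ⟨b, fun a ha => hb ⟨a, ha, rfl⟩⟩

theorem coarse_up {A B : Type*} [Group A] [Group B] (f : A →* B) {SA : Set A}
    {SB : Set B} (hA : Gen SA) (hfA : SA.Finite) (r : ℕ) :
    ∃ r', ∀ x y, wordDist SA x y ≤ r → wordDist SB (f x) (f y) ≤ r' := by
  obtain ⟨r', h⟩ := ball_bound (ball_finite hA hfA r) (fun a => wordDist SB 1 (f a))
  refine ⟨r', fun x y hxy => ?_⟩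
  rw [wordDist_left, ← map_inv, ← map_mul]
  rw [wordDist_left] at hxy
  exact h _ hxy

theorem coarse_down {A B : Type*} [Group A] [Group B] (f : A →* B) (hf : Function.Injective f)
    {SA : Set A} {SB : Set B} (hB : Gen SB) (hfB : SB.Finite) (r : ℕ) :
    ∃ r', ∀ x y, wordDist SB (f x) (f y) ≤ r → wordDist SA x y ≤ r' := by
  obtain ⟨r', h⟩ := ball_bound ((ball_finite hB hfB r).preimage hf.injOn)
    (fun a => wordDist SA 1 a)
  refine ⟨r', fun x y hxy => ?_⟩
  rw [wordDist_left]
  rw [wordDist_left, ← map_inv, ← map_mul] at hxy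
  exact h _ hxy

theorem col_of_asdim {X : Type*} {d : X → X → ℕ} {n : ℕ}
    (h : ASDimLEdist (fun a b => (d a b : ℝ)) n) (r : ℕ) : ∃ D, Col d n univ r D := by
  obtain ⟨U, h1, h2⟩ := h (r + 1) (by positivity)
  choose c s hs hz using h2
  choose R hR using fun i => (h1 i).1
  refine ⟨Finset.univ.sup (fun i => ⌈R i⌉₊), c, s, ?_, ?_⟩
  · intro x _ y _ hc hxy
    by_contra hne
    have := (h1 (c x)).2 (s x) (hs x) (s y) (hc ▸ hs y) hne x (hz x) y (hz y)
    have h' : (d x y : ℝ) ≤ r := by exact_mod_cast hxy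
    linarith
  · intro x _ y _ hc hxy
    have := hR (c x) (s x) (hs x) x (hz x) y (hxy ▸ hz y)
    simp only at this
    have h' : d x y ≤ ⌈R (c x)⌉₊ := by exact_mod_cast this.trans (Nat.le_ceil _)
    exact h'.trans (Finset.le_sup (f := fun i => ⌈R i⌉₊) (Finset.mem_univ (c x)))

theorem asdim_of_col {X : Type*} {d d' : X → X → ℕ} {n : ℕ}
    (h : ∀ r, ∃ D, Col d n univ r D)
    (h1 : ∀ r, ∃ r', ∀ x y, d' x y ≤ r → d x y ≤ r')
    (h2 : ∀ r, ∃ r', ∀ x y, d x y ≤ r → d' x y ≤ r') :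
    ASDimLEdist (fun a b => (d' a b : ℝ)) n := by
  intro δ hδ
  obtain ⟨r, hr⟩ := h1 ⌈δ⌉₊
  obtain ⟨D, c, s, hc, hD⟩ := h r
  obtain ⟨D', hD'⟩ := h2 D
  refine ⟨fun i => {U | ∃ x, U = {y | c y = i ∧ s y = s x}}, ?_, ?_⟩
  · intro i
    constructor
    · refine ⟨D', ?_⟩
      rintro _ ⟨x0, rfl⟩ x ⟨hx1, hx2⟩ y ⟨hy1, hy2⟩
      have := hD' x y (hD x trivial y trivial (hx1.trans hy1.symm) (hx2.trans hy2.symm))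
      simp only
      exact_mod_cast this
    · rintro _ ⟨x0, rfl⟩ _ ⟨y0, rfl⟩ hne x ⟨hx1, hx2⟩ y ⟨hy1, hy2⟩
      by_contra hlt
      apply hne
      have h3 : d' x y ≤ ⌈δ⌉₊ := by
        have := (not_le.1 hlt).le.trans (Nat.le_ceil δ)
        simp only at this
        exact_mod_cast this
      have := hc x trivial y trivial (hx1.trans hy1.symm) (hr x y h3)
      rw [← hx2, ← hy2, this]
  · intro z
    exact ⟨c z, {y | c y = c z ∧ s y = s z}, ⟨z, rfl⟩, rfl, rfl⟩

section HNN
open HNNExtension HNNExtension.NormalWord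

theorem unitsSMul_toList {G : Type*} [Group G] {A B : Subgroup G} (φ : A ≃* B)
    {d : TransversalPair G A B} (u : ℤˣ) (w : NormalWord d) :
    (∃ a, w.toList = a :: (unitsSMul φ u w).toList) ∨
    ∃ a, (unitsSMul φ u w).toList = a :: w.toList := by
  rw [unitsSMul]
  split_ifs with hcan
  · left
    cases w using consRecOn with
    | ofGroup g => simp [Cancels] at hcan
    | cons g u' w h1 h2 =>
      refine ⟨(u', w.head), ?_⟩
      simp [unitsSMulWithCancel]
  · right
    exact ⟨_, rfl⟩

theorem of_smul_toList {G : Type*} [Group G] {A B : Subgroup G} (φ : A ≃* B)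
    {d : TransversalPair G A B} (g : G) (w : NormalWord d) :
    ((of g : HNNExtension G A B φ) • w).toList = w.toList := by
  rw [of_smul_eq_smul, group_smul_toList]

theorem exists_of_toList_eq {G : Type*} [Group G] {A B : Subgroup G} (φ : A ≃* B)
    (d : TransversalPair G A B) (x y : HNNExtension G A B φ)
    (h : (x⁻¹ • (empty : NormalWord d)).toList = (y⁻¹ • (empty : NormalWord d)).toList) :
    ∃ g : G, y = x * of g := by
  set w := x⁻¹ • (empty : NormalWord d) with hw
  set w' := y⁻¹ • (empty : NormalWord d) with hw'
  have e : (w.head * w'.head⁻¹) • w' = w := by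
    apply NormalWord.ext
    · simp
    · rw [group_smul_toList, h]
  have e2 := congrArg (fun w => w.prod φ) e
  have p1 : w.prod φ = x⁻¹ := by
    rw [hw, prod_smul]
    exact (congrArg (x⁻¹ * ·) (prod_empty φ)).trans (mul_one _)
  have p2 : w'.prod φ = y⁻¹ := by
    rw [hw', prod_smul]
    exact (congrArg (y⁻¹ * ·) (prod_empty φ)).trans (mul_one _)
  simp only [prod_group_smul, p1, p2] at e2
  refine ⟨w.head * w'.head⁻¹, ?_⟩
  rw [← mul_left_inj y⁻¹, mul_assoc, e2]
  simp

end HNN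

/-- If `G` is a finitely generated group with `asdim G ≤ n` and `φ : H ≃ H'` is an
isomorphism between two finitely generated subgroups of `G`, then the HNN extension
`G∗_φ` satisfies `asdim (G∗_φ) ≤ n + 1` (with respect to any word metric). -/
theorem asdim_HNN_extension_le {G : Type*} [Group G] (H H' : Subgroup G)
    (φ : H ≃* H') (hH : Group.FG H) (hH' : Group.FG H') (n : ℕ)
    (hG : ∃ S : Finset G, Subgroup.closure (S : Set G) = ⊤ ∧ (∀ s ∈ S, s⁻¹ ∈ S) ∧
      ASDimLEdist (fun a b : G => (wordDist (S : Set G) a b : ℝ)) n) :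
    ∀ S : Finset (HNNExtension G H H' φ),
      Subgroup.closure (S : Set (HNNExtension G H H' φ)) = ⊤ →
      (∀ s ∈ S, s⁻¹ ∈ S) →
      ASDimLEdist
        (fun a b : HNNExtension G H H' φ =>
          (wordDist (S : Set (HNNExtension G H H' φ)) a b : ℝ)) (n + 1) := by
  intro S hS hSs
  obtain ⟨SG, hSG, hSGs, hdim⟩ := hG
  have hGenG : Gen (SG : Set G) := gen_of_closure hSG hSGs
  have hGenS : Gen (S : Set (HNNExtension G H H' φ)) := gen_of_closure hS hSs
  let f : G →* HNNExtension G H H' φ := HNNExtension.of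
  have hf : Function.Injective f := HNNExtension.of_injective φ
  let τ : HNNExtension G H H' φ := HNNExtension.t
  let S0 : Set (HNNExtension G H H' φ) := f '' (SG : Set G) ∪ {τ, τ⁻¹}
  have hS0s : ∀ s ∈ S0, s⁻¹ ∈ S0 := by
    rintro s (⟨g, hg, rfl⟩ | rfl | rfl)
    · exact Or.inl ⟨g⁻¹, hSGs g hg, map_inv f g⟩
    · exact Or.inr (Or.inr rfl)
    · exact Or.inr (Or.inl (inv_inv _))
  have hS0c : Subgroup.closure S0 = ⊤ := by
    rw [eq_top_iff]
    intro x _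
    induction x using HNNExtension.induction_on with
    | of g =>
      have hg : f g ∈ (Subgroup.closure (SG : Set G)).map f := ⟨g, by rw [hSG]; trivial, rfl⟩
      rw [MonoidHom.map_closure] at hg
      exact Subgroup.closure_mono subset_union_left hg
    | t => exact Subgroup.subset_closure (Or.inr (Or.inl rfl))
    | mul a b ha hb => exact mul_mem (ha trivial) (hb trivial)
    | inv a ha => exact inv_mem (ha trivial)
  have hS0f : S0.Finite := (SG.finite_toSet.image f).union (by simp)
  have hGen0 : Gen S0 := gen_of_closure hS0c hS0s
  have hd : IsGD (wordDist S0) := wordDist_isGD hGen0 hS0s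
  obtain ⟨d⟩ := HNNExtension.NormalWord.TransversalPair.nonempty G H H'
  let v : HNNExtension G H H' φ → List (ℤˣ × G) := fun x =>
    (x⁻¹ • (HNNExtension.NormalWord.empty : HNNExtension.NormalWord d)).toList
  have hadj : ∀ x y, wordDist S0 x y ≤ 1 →
      v x = v y ∨ (∃ a, v x = a :: v y) ∨ ∃ a, v y = a :: v x := by
    intro x y hxy
    have hu : ∀ u : ℤˣ, y⁻¹ = τ ^ (u : ℤ) * x⁻¹ →
        v x = v y ∨ (∃ a, v x = a :: v y) ∨ ∃ a, v y = a :: v x := by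
      intro u h
      right
      simp only [v, h, mul_smul, τ, HNNExtension.NormalWord.t_pow_smul_eq_unitsSMul]
      exact unitsSMul_toList φ u _
    obtain ⟨l, h1, h2, h3⟩ := (wordDist_le_iff hGen0 x y 1).1 hxy
    match l, h1, h2, h3 with
    | [], _, _, h3 =>
      left
      rw [List.prod_nil] at h3
      rw [inv_mul_eq_one.1 h3.symm]
    | [s], _, h2, h3 =>
      rw [List.prod_singleton] at h3
      have hy : y⁻¹ = s⁻¹ * x⁻¹ := by rw [h3]; group
      rcases h2 s (by simp) with ⟨g, hg, rfl⟩ | rfl | rfl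
      · left
        simp only [v, hy, mul_smul, ← map_inv, f, of_smul_toList]
      · exact hu (-1) (by simpa using hy)
      · exact hu 1 (by simpa using hy)
    | a :: b :: l, h1, _, _ => simp at h1
  have hfib : ∀ r, ∃ D, ∀ l, Col (wordDist S0) n {x | v x = l} r D := by
    intro r
    obtain ⟨r', hr'⟩ := coarse_down f hf (SA := (SG : Set G)) hGen0 hS0f r
    obtain ⟨D, c, s, hc, hD⟩ := col_of_asdim hdim r'
    obtain ⟨D', hD'⟩ := coarse_up f (SB := S0) hGenG SG.finite_toSet D
    refine ⟨D', fun l => ?_⟩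
    by_cases hl : ∃ x0, v x0 = l
    · obtain ⟨x0, hx0⟩ := hl
      have hex : ∀ x, ∃ g, v x = l → x = x0 * f g := by
        intro x
        by_cases hx : v x = l
        · obtain ⟨g, hg⟩ := exists_of_toList_eq φ d x0 x (hx0.trans hx.symm)
          exact ⟨g, fun _ => hg⟩
        · exact ⟨1, fun h => absurd h hx⟩
      choose g hg using hex
      have hdist : ∀ x y, v x = l → v y = l →
          wordDist S0 x y = wordDist S0 (f (g x)) (f (g y)) := by
        intro x y hx hy
        rw [wordDist_left S0 x y, wordDist_left S0 (f (g x))]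
        conv_lhs => rw [hg x hx, hg y hy]
        congr 1
        group
      refine Col.of_label (c ∘ g) (s ∘ g) ?_ ?_
      · intro x hx y hy hcc hxy
        rw [hdist x y hx hy] at hxy
        exact hc _ trivial _ trivial hcc (hr' _ _ hxy)
      · intro x hx y hy hcc hss
        rw [hdist x y hx hy]
        exact hD' _ _ (hD _ trivial _ trivial hcc hss)
    · exact ⟨fun _ => 0, fun _ => ∅, fun x hx => absurd ⟨x, hx⟩ hl,
        fun x hx => absurd ⟨x, hx⟩ hl⟩
  refine asdim_of_col (tree_asdim hd n v hadj hfib) ?_ ?_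
  · exact coarse_up (MonoidHom.id _) hGenS S.finite_toSet
  · exact coarse_up (MonoidHom.id _) hGen0 hS0f
end
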